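/- For any integer l ≥ 3 and complex numbers x, y, one has Σ_{n=2}^{l−1} (y−x)^{n−2} [ G_l^n(x+y, y) + (−1)^n G_l^n(y+x, x) ] = [ (y^{l+1} − x^{l+1})/(y x (y−x)) − (y−x)^{l−2} ( (1+(−1)^l)(2^{l−1}−1)/2^{l−1} + (−1)^l x/y + y/x ) ] ζ(l), where for x = y and for xy = 0 the displayed rational expressions are interpreted by their polynomial limits. -/

import Mathlib

open scoped BigOperators

/-- The multiple zeta value `ζ(l₁, …, lₙ)`, as a sum over strictly decreasing
tuples of positive integers. -/
noncomputable def mzv {n : ℕ} (l : Fin n → ℕ) : ℝ :=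
  ∑' m : {m : Fin n → ℕ // StrictAnti m ∧ ∀ i, 0 < m i},
    ∏ i, ((m.1 i : ℝ) ^ (l i))⁻¹

/-- The Riemann zeta value `ζ(k)`. -/
noncomputable def rz (k : ℕ) : ℝ := ∑' m : ℕ+, ((m : ℝ) ^ k)⁻¹

/-- The weighted sum with two parameters
`G_l^n(x,y) = Σ_{l₁≥2, l₂,…,lₙ≥1, l₁+⋯+lₙ=l} x^(l₁-1) y^(l-l₁-(n-1)) ζ(l₁,…,lₙ)`. -/
noncomputable def G (l n : ℕ) (x y : ℂ) : ℂ :=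
  match n with
  | 0 => 0
  | k + 1 =>
    ∑ c ∈ (Finset.Nat.antidiagonalTuple (k + 1) l).filter
        (fun c => 2 ≤ c 0 ∧ ∀ i, 1 ≤ c i),
      x ^ (c 0 - 1) * y ^ (l - c 0 - k) * (mzv c : ℂ)

section

open Filter Topology

/-- The ratio `(a)ₖ / (b)ₖ` of Pochhammer symbols. -/
noncomputable def pochRatio (a b : ℂ) (k : ℕ) : ℂ := ∏ j ∈ Finset.range k, (a + j) / (b + j)

@[simp] lemma pochRatio_zero (a b : ℂ) : pochRatio a b 0 = 1 := by simp [pochRatio]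

lemma pochRatio_succ (a b : ℂ) (k : ℕ) :
    pochRatio a b (k + 1) = pochRatio a b k * ((a + k) / (b + k)) := by
  simp only [pochRatio, Finset.prod_range_succ]

lemma norm_pochRatio_le {a b : ℂ} {α : ℝ} (h0 : 0 ≤ α) (h1 : α ≤ 9 / 8)
    (ha : ∀ j : ℕ, ‖a + j‖ ≤ j + α) (hb : ∀ j : ℕ, j + α + 1 / 2 ≤ ‖b + j‖) (k : ℕ) :
    ‖pochRatio a b k‖ ≤ 1 / √(k + 1) := by
  have key : ‖pochRatio a b k‖ ^ 2 * (k + 1) ≤ 1 := by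
    induction k with
    | zero => simp
    | succ k ih =>
      refine le_trans ?_ ih
      have hbp : 0 < ‖b + k‖ := lt_of_lt_of_le (by positivity) (hb k)
      rw [pochRatio_succ, norm_mul, norm_div, mul_pow, mul_assoc]
      refine mul_le_mul_of_nonneg_left ?_ (by positivity)
      rw [div_pow, div_mul_eq_mul_div, div_le_iff₀ (by positivity)]
      have hk : (0 : ℝ) ≤ k := by positivity
      have e1 : ‖a + k‖ ^ 2 ≤ (k + α) ^ 2 := pow_le_pow_left₀ (norm_nonneg _) (ha k) 2
      have e2 : (k + α + 1 / 2) ^ 2 ≤ ‖b + k‖ ^ 2 := pow_le_pow_left₀ (by positivity) (hb k) 2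
      calc ‖a + k‖ ^ 2 * ((k + 1 : ℕ) + 1) ≤ (k + α) ^ 2 * (k + 2) := by
            push_cast; rw [add_assoc (k : ℝ)]; norm_num
            exact mul_le_mul_of_nonneg_right e1 (by positivity)
        _ ≤ (k + 1) * (k + α + 1 / 2) ^ 2 := by nlinarith
        _ ≤ _ := mul_le_mul_of_nonneg_left e2 (by positivity)
  rw [le_div_iff₀ (by positivity)]
  refine abs_le_one_iff_mul_self_le_one.2 ?_ |> (le_abs_self _).trans
  have : √((k : ℝ) + 1) * √((k : ℝ) + 1) = k + 1 := Real.mul_self_sqrt (by positivity)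
  nlinarith

lemma half_le_norm_natCast_add {z : ℂ} (hz : ‖z‖ ≤ 1 / 2) (n : ℕ) :
    ((n : ℝ) + 1) / 2 ≤ ‖(n : ℂ) + 1 + z‖ := by
  have h1 : ‖(n : ℂ) + 1‖ = n + 1 := by
    have := Complex.norm_natCast (n + 1); push_cast at this; exact this
  have h2 := norm_sub_le_norm_add ((n : ℂ) + 1) z
  have : (0 : ℝ) ≤ n := by positivity
  linarith

lemma natCast_add_ne_zero {z : ℂ} (hz : ‖z‖ ≤ 1 / 2) (n : ℕ) : (n : ℂ) + 1 + z ≠ 0 := by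
  have := half_le_norm_natCast_add hz n
  exact norm_pos_iff.1 (lt_of_lt_of_le (by positivity) this)

lemma norm_inv_natCast_add_le {z : ℂ} (hz : ‖z‖ ≤ 1 / 2) (n : ℕ) :
    ‖((n : ℂ) + 1 + z)⁻¹‖ ≤ 2 / (n + 1) := by
  rw [norm_inv, ← inv_div]
  exact inv_anti₀ (by positivity) (half_le_norm_natCast_add hz n)

lemma summable_one_div_sqrt_mul : Summable fun n : ℕ => 1 / √((n : ℝ) + 1) * (1 / (n + 1)) := by
  have h := (summable_nat_add_iff 1).2 (Real.summable_one_div_nat_rpow.2 (by norm_num : (1 : ℝ) < 3 / 2))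
  refine h.congr fun n => ?_
  have hn : (0 : ℝ) < n + 1 := by positivity
  push_cast
  rw [Real.sqrt_eq_rpow, div_mul_div_comm, one_mul, ← Real.rpow_add_one hn.ne']
  norm_num

lemma tendsto_one_div_sqrt : Tendsto (fun n : ℕ => 1 / √((n : ℝ) + 1)) atTop (𝓝 0) := by
  have h : Tendsto (fun n : ℕ => √((n : ℝ) + 1)) atTop atTop :=
    Real.tendsto_sqrt_atTop.comp (tendsto_natCast_atTop_atTop.atTop_add tendsto_const_nhds)
  simp only [one_div]
  exact h.inv_tendsto_atTop

/-- Terms of size `n ^ (-1/2)` divided by `n + 1 + z` are summable. -/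
lemma summable_div_natCast_add {f : ℕ → ℂ} {C : ℝ} (hf : ∀ n, ‖f n‖ ≤ C * (1 / √((n : ℝ) + 1)))
    {z : ℂ} (hz : ‖z‖ ≤ 1 / 2) : Summable fun n : ℕ => f n / (n + 1 + z) := by
  refine Summable.of_norm_bounded (summable_one_div_sqrt_mul.mul_left (C * 2)) fun n => ?_
  rw [div_eq_mul_inv, norm_mul]
  calc _ ≤ C * (1 / √((n : ℝ) + 1)) * (2 / (n + 1)) :=
        mul_le_mul (hf n) (norm_inv_natCast_add_le hz n) (norm_nonneg _)
          ((norm_nonneg _).trans (hf n))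
    _ = _ := by ring

section small

variable {x y : ℂ}

lemma norm_pochRatio_small (hx : ‖x‖ ≤ 1 / 8) (hy : ‖y‖ ≤ 1 / 8) (k : ℕ) :
    ‖pochRatio x (1 - y) k‖ ≤ 1 / √(k + 1) := by
  refine norm_pochRatio_le (α := 1 / 8) (by norm_num) (by norm_num) (fun j => ?_) (fun j => ?_) k
  · have := norm_add_le x j
    rw [Complex.norm_natCast] at this
    linarith
  · have := norm_sub_norm_le ((j + 1 : ℕ) : ℂ) y
    rw [Complex.norm_natCast] at this
    rw [show 1 - y + (j : ℂ) = ((j + 1 : ℕ) : ℂ) - y by push_cast; ring]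
    push_cast at this ⊢
    linarith

lemma norm_pochRatio_shift (hx : ‖x‖ ≤ 1 / 8) (hy : ‖y‖ ≤ 1 / 8) (k m : ℕ) :
    ‖pochRatio (1 - x) (1 - y + (k + 1 : ℕ)) m‖ ≤ 1 / √(m + 1) := by
  refine norm_pochRatio_le (α := 9 / 8) (by norm_num) (by norm_num) (fun j => ?_) (fun j => ?_) m
  · have := norm_sub_le ((j + 1 : ℕ) : ℂ) x
    rw [Complex.norm_natCast] at this
    rw [show 1 - x + (j : ℂ) = ((j + 1 : ℕ) : ℂ) - x by push_cast; ring]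
    push_cast at this ⊢
    linarith
  · have := norm_sub_norm_le ((j + k + 2 : ℕ) : ℂ) y
    rw [Complex.norm_natCast] at this
    rw [show 1 - y + ((k + 1 : ℕ) : ℂ) + (j : ℂ) = ((j + k + 2 : ℕ) : ℂ) - y by push_cast; ring]
    have hk : (0 : ℝ) ≤ k := by positivity
    push_cast at this ⊢
    linarith

/-- Gauss summation in its telescoping case. -/
lemma hasSum_pochRatio_div {a b : ℂ} (hb : ∀ m : ℕ, b + m ≠ 0) (hab : b - a ≠ 0)
    (hs : Summable fun m : ℕ => pochRatio a b m / (b + m))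
    (h : Tendsto (pochRatio a b) atTop (𝓝 0)) :
    HasSum (fun m : ℕ => pochRatio a b m / (b + m)) (1 / (b - a)) := by
  refine (hs.hasSum_iff_tendsto_nat).2 ?_
  have h1 : ∀ n : ℕ, ∑ m ∈ Finset.range n, pochRatio a b m / (b + m)
      = (1 - pochRatio a b n) / (b - a) := by
    intro n
    induction n with
    | zero => simp
    | succ n ih =>
      rw [Finset.sum_range_succ, ih, pochRatio_succ]
      have := hb n
      field_simp
      ring
  simp_rw [h1]
  simpa using (h.const_sub 1).div_const (b - a)

/-- The sum `∑ₖ (x)ₖ / ((1 - y)ₖ (k + x - y))` over `k ≥ 1`. -/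
noncomputable def tailSum (x y : ℂ) : ℂ :=
  ∑' k : ℕ, pochRatio x (1 - y) (k + 1) / (k + 1 + (x - y))

/-- The generating function of the sums `G`, as a series over the largest summation index. -/
noncomputable def headSum (x y : ℂ) : ℂ :=
  ∑' m : ℕ, pochRatio (1 - x) (1 - y) m * (1 / (m + 1 - (x + y)) - 1 / (m + 1))

/-- `∑ₖ (1 / (k - z) - 1 / k)` over `k ≥ 1`. -/
noncomputable def digammaSum (z : ℂ) : ℂ := ∑' k : ℕ, (1 / ((k : ℂ) + 1 - z) - 1 / (k + 1))

lemma summable_digammaSum {z : ℂ} (hz : ‖z‖ ≤ 1 / 2) :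
    Summable fun k : ℕ => (1 / ((k : ℂ) + 1 - z) - 1 / (k + 1)) := by
  have h : Summable fun n : ℕ => (z / (n + 1)) / ((n : ℂ) + 1 + (-z)) := by
    refine summable_div_natCast_add (C := ‖z‖) (fun n => ?_) (by simpa using hz)
    rw [norm_div, div_eq_mul_one_div]
    have h1 : ‖(n : ℂ) + 1‖ = n + 1 := by
      have := Complex.norm_natCast (n + 1); push_cast at this; exact this
    rw [h1]
    refine mul_le_mul_of_nonneg_left ?_ (norm_nonneg _)
    have : (1 : ℝ) ≤ n + 1 := by linarith [(by positivity : (0 : ℝ) ≤ n)]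
    refine one_div_le_one_div_of_le (by positivity) ?_
    exact (Real.sqrt_le_left (by positivity)).2 (by nlinarith)
  refine h.congr fun n => ?_
  have h1 := natCast_add_ne_zero (z := -z) (by simpa using hz) n
  have h2 := natCast_add_ne_zero (z := 0) (by simp) n
  rw [← sub_eq_add_neg] at *
  rw [add_zero] at h2
  field_simp
  ring

end small

lemma pochRatio_add_one_right {a b : ℂ} (hb : ∀ m : ℕ, b + m ≠ 0) (m : ℕ) :
    pochRatio a (b + 1) m = pochRatio a b m * (b / (b + m)) := by
  induction m with
  | zero => have := hb 0; simp at this; simp [this]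
  | succ m ih =>
    rw [pochRatio_succ, pochRatio_succ, ih]
    have h1 := hb m
    have h2 := hb (m + 1)
    have h3 : b + 1 + (m : ℂ) ≠ 0 := by convert h2 using 1; push_cast; ring
    push_cast at h2 ⊢
    rw [show b + ((m : ℂ) + 1) = b + 1 + m by ring]
    field_simp

section small

variable {x y : ℂ}

lemma pochRatio_neg_one_sub (hy : ‖y‖ ≤ 1 / 8) (k : ℕ) :
    pochRatio (-y) (1 - y) (k + 1) = -y / (k + 1 - y) := by
  have hn : ∀ k : ℕ, (k : ℂ) + 1 - y ≠ 0 := fun k => by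
    have := natCast_add_ne_zero (z := -y) (by rw [norm_neg]; linarith) k
    rwa [← sub_eq_add_neg] at this
  induction k with
  | zero => simp [pochRatio]
  | succ k ih =>
    rw [pochRatio_succ, ih]
    have h1 := hn k
    have h2 := hn (k + 1)
    push_cast at h2 ⊢
    have h3 : 1 - y + ((k : ℂ) + 1) ≠ 0 := by convert h2 using 1; ring
    rw [show -y + ((k : ℂ) + 1) = k + 1 - y by ring,
      show 1 - y + ((k : ℂ) + 1) = k + 1 + 1 - y by ring]
    field_simp

/-- The summand of the `k`-th step of the transformation from `headSum` to `tailSum`. -/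
noncomputable def connTerm (x y : ℂ) (k m : ℕ) : ℂ :=
  pochRatio (1 - x) (1 - y + k) m *
    (pochRatio x (1 - y) k / (m + 1 - (x + y)) - pochRatio (-y) (1 - y) k / (m + 1))

lemma connTerm_sub (hx : ‖x‖ ≤ 1 / 8) (hy : ‖y‖ ≤ 1 / 8) (k m : ℕ) :
    connTerm x y k m - connTerm x y (k + 1) m =
      (pochRatio x (1 - y) k - pochRatio (-y) (1 - y) k) *
        (pochRatio (1 - x) (1 - y + k) m / (1 - y + k + m)) := by
  have hn : ∀ k : ℕ, 1 - y + (k : ℂ) ≠ 0 := fun k => by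
    have := natCast_add_ne_zero (z := -y) (by rw [norm_neg]; linarith) k
    convert this using 1; ring
  have hb : ∀ m : ℕ, 1 - y + (k : ℂ) + m ≠ 0 := fun m => by
    have := hn (k + m); push_cast at this; rwa [add_assoc]
  have hs := natCast_add_ne_zero (z := -(x + y))
    (by rw [norm_neg]; linarith [norm_add_le x y]) m
  rw [← sub_eq_add_neg] at hs
  have hm := natCast_add_ne_zero (z := 0) (by simp) m
  rw [add_zero] at hm
  have hk := hn k
  have hkm := hb m
  simp only [connTerm]
  rw [show 1 - y + ((k + 1 : ℕ) : ℂ) = 1 - y + k + 1 by push_cast; ring,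
    pochRatio_add_one_right hb, pochRatio_succ, pochRatio_succ]
  field_simp
  ring

lemma summable_pochRatio_shift_div (hx : ‖x‖ ≤ 1 / 8) (hy : ‖y‖ ≤ 1 / 8) {z : ℂ}
    (hz : ‖z‖ ≤ 1 / 2) (k : ℕ) :
    Summable fun m : ℕ => pochRatio (1 - x) (1 - y + (k + 1 : ℕ)) m / (m + 1 + z) :=
  summable_div_natCast_add (C := 1) (fun m => by
    rw [one_mul]; exact norm_pochRatio_shift hx hy k m) hz

lemma hasSum_connTerm (hx : ‖x‖ ≤ 1 / 8) (hy : ‖y‖ ≤ 1 / 8) (k : ℕ) :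
    HasSum (connTerm x y (k + 1))
      (pochRatio x (1 - y) (k + 1) *
          ∑' m : ℕ, pochRatio (1 - x) (1 - y + (k + 1 : ℕ)) m / (m + 1 + (-(x + y))) -
        pochRatio (-y) (1 - y) (k + 1) *
          ∑' m : ℕ, pochRatio (1 - x) (1 - y + (k + 1 : ℕ)) m / (m + 1 + 0)) := by
  have h1 := (summable_pochRatio_shift_div hx hy (z := -(x + y))
    (by rw [norm_neg]; linarith [norm_add_le x y]) k).hasSum.mul_left (pochRatio x (1 - y) (k + 1))
  have h2 := (summable_pochRatio_shift_div hx hy (z := 0)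
    (by simp) k).hasSum.mul_left (pochRatio (-y) (1 - y) (k + 1))
  refine (h1.sub h2).congr_fun ?_
  intro m
  simp only [connTerm]
  ring

lemma norm_tsum_pochRatio_shift_div_le (hx : ‖x‖ ≤ 1 / 8) (hy : ‖y‖ ≤ 1 / 8) {z : ℂ}
    (hz : ‖z‖ ≤ 1 / 2) (k : ℕ) :
    ‖∑' m : ℕ, pochRatio (1 - x) (1 - y + (k + 1 : ℕ)) m / (m + 1 + z)‖
      ≤ ∑' n : ℕ, 2 * (1 / √((n : ℝ) + 1) * (1 / (n + 1))) := by
  refine tsum_of_norm_bounded (summable_one_div_sqrt_mul.mul_left 2).hasSum fun m => ?_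
  rw [div_eq_mul_inv, norm_mul]
  calc _ ≤ (1 / √((m : ℝ) + 1)) * (2 / (m + 1)) :=
        mul_le_mul (norm_pochRatio_shift hx hy k m) (norm_inv_natCast_add_le hz m)
          (norm_nonneg _) (by positivity)
    _ = _ := by ring

lemma tendsto_tsum_connTerm (hx : ‖x‖ ≤ 1 / 8) (hy : ‖y‖ ≤ 1 / 8) :
    Tendsto (fun k => ∑' m, connTerm x y (k + 1) m) atTop (𝓝 0) := by
  set C : ℝ := ∑' n : ℕ, 2 * (1 / √((n : ℝ) + 1) * (1 / (n + 1)))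
  have hC : 0 ≤ C := tsum_nonneg fun n => by positivity
  have h0 : Tendsto (fun k : ℕ => 2 * C * (1 / √((k + 1 : ℕ) + 1 : ℝ))) atTop (𝓝 0) := by
    simpa using ((tendsto_add_atTop_iff_nat 1).2 tendsto_one_div_sqrt).const_mul (2 * C)
  refine squeeze_zero_norm (fun k => ?_) h0
  rw [(hasSum_connTerm hx hy k).tsum_eq]
  refine (norm_sub_le _ _).trans ?_
  rw [norm_mul, norm_mul]
  have e1 := mul_le_mul (norm_pochRatio_small hx hy (k + 1))
    (norm_tsum_pochRatio_shift_div_le hx hy (z := -(x + y))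
    (by rw [norm_neg]; linarith [norm_add_le x y]) k) (norm_nonneg _) (by positivity)
  have e2 := mul_le_mul (norm_pochRatio_small (x := -y) (by rwa [norm_neg]) hy (k + 1))
    (norm_tsum_pochRatio_shift_div_le hx hy (z := 0) (by simp) k) (norm_nonneg _) (by positivity)
  linarith

lemma tsum_connTerm_sub (hx : ‖x‖ ≤ 1 / 8) (hy : ‖y‖ ≤ 1 / 8) (k : ℕ) :
    ∑' m, connTerm x y (k + 1) m - ∑' m, connTerm x y (k + 1 + 1) m =
      (pochRatio x (1 - y) (k + 1) - pochRatio (-y) (1 - y) (k + 1)) / (k + 1 + (x - y)) := by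
  have hd : ‖x - y‖ ≤ 1 / 2 := by linarith [norm_sub_le x y]
  have hb : ∀ m : ℕ, 1 - y + ((k + 1 : ℕ) : ℂ) + m ≠ 0 := fun m => by
    have := natCast_add_ne_zero (z := -y) (by rw [norm_neg]; linarith) (k + 1 + m)
    convert this using 1; push_cast; ring
  have e : 1 - y + ((k + 1 : ℕ) : ℂ) - (1 - x) = k + 1 + (x - y) := by push_cast; ring
  have hg := hasSum_pochRatio_div (a := 1 - x) hb (by rw [e]; exact natCast_add_ne_zero hd k) ?_
    (squeeze_zero_norm (norm_pochRatio_shift hx hy k) tendsto_one_div_sqrt)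
  · rw [← (hasSum_connTerm hx hy k).summable.tsum_sub (hasSum_connTerm hx hy (k + 1)).summable]
    simp_rw [connTerm_sub hx hy]
    rw [(hg.mul_left _).tsum_eq, e, mul_one_div]
  · refine Summable.of_norm_bounded (summable_one_div_sqrt_mul.mul_left 2) fun m => ?_
    rw [div_eq_mul_inv, norm_mul]
    have h1 : ‖(1 - y + ((k + 1 : ℕ) : ℂ) + m)⁻¹‖ ≤ 2 / (m + 1) := by
      have := norm_inv_natCast_add_le (z := -y) (by rw [norm_neg]; linarith) (k + 1 + m)
      rw [show 1 - y + ((k + 1 : ℕ) : ℂ) + m = ((k + 1 + m : ℕ) : ℂ) + 1 + -y by push_cast; ring]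
      refine this.trans ?_
      push_cast
      gcongr
      linarith [(by positivity : (0 : ℝ) ≤ k)]
    calc _ ≤ (1 / √((m : ℝ) + 1)) * (2 / (m + 1)) :=
          mul_le_mul (norm_pochRatio_shift hx hy k m) h1 (norm_nonneg _) (by positivity)
      _ = _ := by ring

lemma summable_tailSum (hx : ‖x‖ ≤ 1 / 8) (hy : ‖y‖ ≤ 1 / 8) {z : ℂ} (hz : ‖z‖ ≤ 1 / 2) :
    Summable fun k : ℕ => pochRatio x (1 - y) (k + 1) / (k + 1 + z) := by
  refine summable_div_natCast_add (C := 1) (fun k => ?_) hz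
  rw [one_mul]
  refine (norm_pochRatio_small hx hy (k + 1)).trans ?_
  push_cast
  gcongr
  linarith

lemma headSum_summand_eq_connTerm (hx : ‖x‖ ≤ 1 / 8) (hy : ‖y‖ ≤ 1 / 8) (m : ℕ) :
    pochRatio (1 - x) (1 - y) m * (1 / (m + 1 - (x + y)) - 1 / (m + 1)) = connTerm x y 1 m := by
  have := connTerm_sub hx hy 0 m
  simp only [pochRatio_zero, sub_self, zero_mul, sub_eq_zero] at this
  rw [← this]
  simp [connTerm]

/-- A nonterminating transformation of `₃F₂` series at `1`. -/
lemma headSum_eq (hx : ‖x‖ ≤ 1 / 8) (hy : ‖y‖ ≤ 1 / 8) (hx0 : x ≠ 0) :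
    headSum x y = tailSum x y + y / x * (digammaSum y - digammaSum (y - x)) := by
  have hd : ‖x - y‖ ≤ 1 / 2 := by linarith [norm_sub_le x y]
  have s1 := summable_tailSum hx hy hd
  have s2 := summable_tailSum (x := -y) (by rwa [norm_neg]) hy hd
  have h : HasSum (fun k : ℕ => pochRatio x (1 - y) (k + 1) / (k + 1 + (x - y)) -
      pochRatio (-y) (1 - y) (k + 1) / (k + 1 + (x - y))) (headSum x y) := by
    refine ((s1.sub s2).hasSum_iff_tendsto_nat).2 ?_
    have e : ∀ n, ∑ k ∈ Finset.range n, (pochRatio x (1 - y) (k + 1) / (k + 1 + (x - y)) -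
        pochRatio (-y) (1 - y) (k + 1) / (k + 1 + (x - y))) =
        headSum x y - ∑' m, connTerm x y (n + 1) m := by
      intro n
      simp_rw [← sub_div, ← tsum_connTerm_sub hx hy]
      rw [Finset.sum_range_sub' (fun n => ∑' m, connTerm x y (n + 1) m), headSum]
      simp_rw [headSum_summand_eq_connTerm hx hy]
    simp_rw [e]
    simpa using (tendsto_tsum_connTerm hx hy).const_sub (headSum x y)
  rw [← h.tsum_eq, s1.tsum_sub s2, tailSum, sub_eq_add_neg, ← tsum_neg, digammaSum, digammaSum,
    ← (summable_digammaSum (by linarith)).tsum_sub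
      (summable_digammaSum (by rwa [norm_sub_rev])), ← tsum_mul_left]
  congr 1
  refine tsum_congr fun k => ?_
  rw [pochRatio_neg_one_sub hy]
  have h1 := natCast_add_ne_zero (z := -y) (by rw [norm_neg]; linarith) k
  have h2 := natCast_add_ne_zero hd k
  rw [← sub_eq_add_neg] at h1
  rw [show (k : ℂ) + 1 - (y - x) = k + 1 + (x - y) by ring]
  field_simp
  ring

end small

lemma tendsto_inv_natCast_add (z : ℂ) : Tendsto (fun n : ℕ => ((n : ℂ) + z)⁻¹) atTop (𝓝 0) :=
  tendsto_inv₀_cobounded.comp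
    ((tendsto_add_const_cobounded z).comp (tendsto_natCast_atTop_cobounded (α := ℂ)))

/-- Lowering both parameters by one changes `tailSum` by a symmetric rational function. -/
lemma tailSum_sub_one {x y : ℂ} (hy : ∀ k : ℕ, 1 - y + k ≠ 0)
    (hd : ∀ k : ℕ, (k : ℂ) + 1 + (x - y) ≠ 0) (hs1 : x + y - 1 ≠ 0) (hs2 : x + y - 2 ≠ 0)
    (h0 : Tendsto (pochRatio x (1 - y)) atTop (𝓝 0))
    (s1 : Summable fun k : ℕ => pochRatio x (1 - y) (k + 1) / (k + 1 + (x - y)))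
    (s2 : Summable fun k : ℕ =>
      pochRatio (x - 1) (1 - (y - 1)) (k + 1) / (k + 1 + (x - 1 - (y - 1)))) :
    tailSum x y = 1 / ((x + y - 1) * (x + y - 2)) + tailSum (x - 1) (y - 1) := by
  set g : ℕ → ℂ := fun k => pochRatio x (1 - y) k *
    (k + 1 + (1 - x) / (x + y - 2)) / ((1 - y + k) * (x + y - 1)) with hg
  have shift : ∀ k : ℕ, pochRatio (x - 1) (1 - (y - 1)) (k + 1) =
      pochRatio x (1 - y) k * ((x - 1) * (1 - y) / ((1 - y + k) * (1 - y + (k + 1 : ℕ)))) := by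
    intro k
    induction k with
    | zero =>
      have h1 := hy 0
      have h2 := hy 1
      simp only [Nat.cast_zero, add_zero, zero_add, Nat.cast_one] at *
      rw [pochRatio_succ]
      simp only [pochRatio_zero, one_mul, Nat.cast_zero, add_zero]
      rw [show 1 - (y - 1) = 1 - y + 1 by ring]
      field_simp
    | succ k ih =>
      rw [pochRatio_succ, ih, pochRatio_succ]
      have h1 := hy k
      have h2 := hy (k + 1)
      have h3 := hy (k + 1 + 1)
      rw [show x - 1 + ((k + 1 : ℕ) : ℂ) = x + k by push_cast; ring,
        show 1 - (y - 1) + ((k + 1 : ℕ) : ℂ) = 1 - y + (k + 1 + 1 : ℕ) by push_cast; ring]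
      field_simp
  have step : ∀ k : ℕ, pochRatio x (1 - y) (k + 1) / (k + 1 + (x - y)) -
      pochRatio (x - 1) (1 - (y - 1)) (k + 1) / (k + 1 + (x - 1 - (y - 1))) = g (k + 1) - g k := by
    intro k
    rw [shift, show x - 1 - (y - 1) = x - y by ring, hg]
    simp only
    rw [pochRatio_succ]
    have h1 := hy k
    have h2 := hy (k + 1)
    have h3 := hd k
    push_cast at h2 ⊢
    rw [show (k : ℂ) + 1 + (x - y) = k + 1 + x - y by ring] at *
    rw [show 1 - y + ((k : ℂ) + 1) = k + 2 - y by ring] at *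
    rw [show 1 - y + (k : ℂ) = k + 1 - y by ring] at *
    field_simp
    ring
  have lim : Tendsto g atTop (𝓝 0) := by
    have h2 : Tendsto (fun k : ℕ => (1 + ((1 - x) / (x + y - 2) + y) * ((k : ℂ) + (1 - y))⁻¹) *
        (pochRatio x (1 - y) k / (x + y - 1))) atTop (𝓝 0) := by
      simpa using (((tendsto_inv_natCast_add (1 - y)).const_mul
        ((1 - x) / (x + y - 2) + y)).const_add 1).mul (h0.div_const (x + y - 1))
    refine h2.congr fun k => ?_
    have h1 := hy k
    rw [add_comm] at h1
    simp only [hg]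
    rw [add_comm (1 - y)]
    field_simp
    ring
  have h : HasSum (fun k : ℕ => pochRatio x (1 - y) (k + 1) / (k + 1 + (x - y)) -
      pochRatio (x - 1) (1 - (y - 1)) (k + 1) / (k + 1 + (x - 1 - (y - 1)))) (-g 0) := by
    refine ((s1.sub s2).hasSum_iff_tendsto_nat).2 ?_
    simp_rw [step, Finset.sum_range_sub]
    simpa using lim.sub_const (g 0)
  have h' := h.tsum_eq
  rw [s1.tsum_sub s2, sub_eq_iff_eq_add] at h'
  rw [tailSum, h', tailSum]
  congr 1
  have h1 := hy 0
  simp only [Nat.cast_zero, add_zero] at h1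
  simp only [hg, pochRatio_zero, Nat.cast_zero, add_zero, zero_add, one_mul]
  field_simp
  ring

lemma tendsto_pochRatio_shift (x y : ℂ) (k : ℕ) :
    Tendsto (fun N : ℕ => pochRatio (x - N + 1) (1 - (y - N)) k) atTop (𝓝 ((-1) ^ k)) := by
  have h : ∀ j ∈ Finset.range k,
      Tendsto (fun N : ℕ => (x - N + 1 + j) / (1 - (y - N) + j)) atTop (𝓝 (-1)) := by
    intro j _
    have h1 : Tendsto (fun N : ℕ => -1 + (x - y + 2 + 2 * j) * ((N : ℂ) + (1 - y + j))⁻¹) atTop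
        (𝓝 (-1)) := by
      simpa using ((tendsto_inv_natCast_add (1 - y + j)).const_mul (x - y + 2 + 2 * j)).const_add (-1)
    have h2 : ∀ᶠ N : ℕ in atTop, (N : ℂ) + (1 - y + j) ≠ 0 := by
      filter_upwards [((tendsto_add_const_cobounded (1 - y + j)).comp
        (tendsto_natCast_atTop_cobounded (α := ℂ))).eventually_ne_cobounded 0] with N hN
      exact hN
    refine h1.congr' ?_
    filter_upwards [h2] with N hN
    rw [show 1 - (y - (N : ℂ)) + j = N + (1 - y + j) by ring]
    field_simp
    ring
  simpa [pochRatio] using tendsto_finsetProd (Finset.range k) h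

section small

variable {x y : ℂ}

lemma norm_pochRatio_shift_le_one (hx : ‖x‖ ≤ 1 / 8) (hy : ‖y‖ ≤ 1 / 8) (N k : ℕ) :
    ‖pochRatio (x - (N + 1 : ℕ) + 1) (1 - (y - (N + 1 : ℕ))) k‖ ≤ 1 := by
  rw [pochRatio, norm_prod]
  refine Finset.prod_le_one (fun _ _ => norm_nonneg _) fun j _ => ?_
  rw [norm_div]
  refine div_le_one_of_le₀ ?_ (norm_nonneg _)
  have h1 : ‖x - ((N + 1 : ℕ) : ℂ) + 1 + j‖ ≤ ‖x‖ + |(j : ℝ) - N| := by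
    have : ‖((j : ℝ) - N : ℝ)‖ = ‖(((j : ℝ) - N : ℝ) : ℂ)‖ := (Complex.norm_real _).symm
    rw [Real.norm_eq_abs] at this
    rw [this]
    refine le_of_eq_of_le ?_ (norm_add_le _ _)
    congr 1
    push_cast
    ring
  have h2 : (j : ℝ) + N + 2 - ‖y‖ ≤ ‖1 - (y - ((N + 1 : ℕ) : ℂ)) + j‖ := by
    have := norm_sub_norm_le ((j + N + 2 : ℕ) : ℂ) y
    rw [Complex.norm_natCast] at this
    rw [show 1 - (y - ((N + 1 : ℕ) : ℂ)) + j = ((j + N + 2 : ℕ) : ℂ) - y by push_cast; ring]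
    push_cast at this ⊢
    exact this
  have h3 : |(j : ℝ) - N| ≤ j + N := by
    rw [abs_le]
    constructor <;> linarith [(by positivity : (0 : ℝ) ≤ j), (by positivity : (0 : ℝ) ≤ N)]
  linarith

lemma pochRatio_succ_mul {a b : ℂ} (hb : ∀ k : ℕ, b + k ≠ 0) (k : ℕ) :
    pochRatio a b (k + 1) = a * pochRatio (a + 1) b k / (b + k) := by
  induction k with
  | zero => simp [pochRatio]
  | succ k ih =>
    rw [pochRatio_succ, ih, pochRatio_succ]
    have h1 := hb k
    have h2 := hb (k + 1)
    push_cast at *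
    field_simp
    ring

lemma one_sub_shift_ne_zero (hy : ‖y‖ ≤ 1 / 8) (N k : ℕ) : 1 - (y - N) + k ≠ 0 := by
  have := natCast_add_ne_zero (z := -y) (by rw [norm_neg]; linarith) (N + k)
  convert this using 1
  push_cast
  ring

lemma exists_norm_pochRatio_le (hx : ‖x‖ ≤ 1 / 8) (hy : ‖y‖ ≤ 1 / 8) (N : ℕ) :
    ∃ C : ℝ, ∀ k, ‖pochRatio (x - N) (1 - (y - N)) k‖ ≤ C * (1 / √((k : ℝ) + 1)) := by
  cases N with
  | zero =>
    refine ⟨1, fun k => ?_⟩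
    simpa using norm_pochRatio_small hx hy k
  | succ N =>
    refine ⟨1 + 4 * ‖x - (N + 1 : ℕ)‖, fun k => ?_⟩
    cases k with
    | zero => simp
    | succ k =>
      have h1 : ‖(1 - (y - ((N + 1 : ℕ) : ℂ)) + k)⁻¹‖ ≤ 2 / (k + 1) := by
        have := norm_inv_natCast_add_le (z := -y) (by rw [norm_neg]; linarith) (N + 1 + k)
        rw [show 1 - (y - ((N + 1 : ℕ) : ℂ)) + k = ((N + 1 + k : ℕ) : ℂ) + 1 + -y by
          push_cast; ring]
        refine this.trans ?_
        push_cast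
        gcongr
        linarith [(by positivity : (0 : ℝ) ≤ N)]
      rw [pochRatio_succ_mul (one_sub_shift_ne_zero hy (N + 1)), div_eq_mul_inv, norm_mul, norm_mul]
      have h2 : 2 / ((k : ℝ) + 1) ≤ 4 * (1 / √((k + 1 : ℕ) + 1)) := by
        have hk : (0 : ℝ) ≤ k := by positivity
        have h3 : √(((k + 1 : ℕ) : ℝ) + 1) ≤ k + 2 := by
          rw [Real.sqrt_le_left (by positivity)]; push_cast; nlinarith
        rw [mul_one_div, div_le_div_iff₀ (by positivity) (by positivity)]
        linarith
      calc _ ≤ ‖x - ((N + 1 : ℕ) : ℂ)‖ * 1 * (4 * (1 / √((k + 1 : ℕ) + 1))) := by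
            gcongr
            · exact norm_pochRatio_shift_le_one hx hy N k
            · exact h1.trans h2
        _ ≤ _ := by
            have : 0 ≤ 1 / √(((k + 1 : ℕ) : ℝ) + 1) := by positivity
            linarith

lemma summable_tailSum_shift (hx : ‖x‖ ≤ 1 / 8) (hy : ‖y‖ ≤ 1 / 8) (N : ℕ) :
    Summable fun k : ℕ =>
      pochRatio (x - N) (1 - (y - N)) (k + 1) / (k + 1 + (x - N - (y - N))) := by
  obtain ⟨C, hC⟩ := exists_norm_pochRatio_le hx hy N
  rw [show x - (N : ℂ) - (y - N) = x - y by ring]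
  have hC0 : 0 ≤ C := by simpa using (norm_nonneg _).trans (hC 0)
  refine summable_div_natCast_add (C := C) (fun k => (hC (k + 1)).trans ?_)
    (by linarith [norm_sub_le x y])
  push_cast
  gcongr
  linarith

lemma sum_sub_ne_zero (hx : ‖x‖ ≤ 1 / 8) (hy : ‖y‖ ≤ 1 / 8) (n : ℕ) : x + y - (n + 1) ≠ 0 := by
  have := natCast_add_ne_zero (z := -(x + y))
    (by rw [norm_neg]; linarith [norm_add_le x y]) n
  rw [← neg_ne_zero]
  convert this using 1
  ring

lemma tailSum_sub_tailSum_shift (hx : ‖x‖ ≤ 1 / 8) (hy : ‖y‖ ≤ 1 / 8) (N : ℕ) :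
    tailSum x y - tailSum y x = tailSum (x - N) (y - N) - tailSum (y - N) (x - N) := by
  have key : ∀ {x y : ℂ}, ‖x‖ ≤ 1 / 8 → ‖y‖ ≤ 1 / 8 → ∀ N : ℕ, tailSum (x - N) (y - N) =
      1 / ((x + y - (2 * N + 1 : ℕ)) * (x + y - (2 * N + 2 : ℕ))) +
        tailSum (x - (N + 1 : ℕ)) (y - (N + 1 : ℕ)) := by
    intro x y hx hy N
    have e : ∀ x : ℂ, x - ((N + 1 : ℕ) : ℂ) = x - N - 1 := fun x => by push_cast; ring
    rw [tailSum_sub_one, e, e]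
    · congr 3 <;> (push_cast; ring)
    · exact one_sub_shift_ne_zero hy N
    · intro k
      rw [show x - (N : ℂ) - (y - N) = x - y by ring]
      exact natCast_add_ne_zero (by linarith [norm_sub_le x y]) k
    · convert sum_sub_ne_zero hx hy (2 * N) using 1; push_cast; ring
    · convert sum_sub_ne_zero hx hy (2 * N + 1) using 1; push_cast; ring
    · obtain ⟨C, hC⟩ := exists_norm_pochRatio_le hx hy N
      exact squeeze_zero_norm hC (by simpa using tendsto_one_div_sqrt.const_mul C)
    · exact summable_tailSum_shift hx hy N
    · rw [← e, ← e]
      exact summable_tailSum_shift hx hy (N + 1)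
  induction N with
  | zero => simp
  | succ N ih =>
    rw [ih, key hx hy, key hy hx, add_comm y x]
    ring

lemma norm_div_mul_le {z : ℂ} (hz : ‖z‖ ≤ 1 / 2) {c : ℂ} (hc : ‖c‖ ≤ 1) (k : ℕ) :
    ‖c / (((k : ℂ) + 1 + z) * (k + 2 + z))‖ ≤ 4 * (1 / √((k : ℝ) + 1) * (1 / (k + 1))) := by
  have h1 := norm_inv_natCast_add_le hz k
  have h2 := norm_inv_natCast_add_le hz (k + 1)
  have hk : (0 : ℝ) ≤ k := by positivity
  rw [div_eq_mul_inv, mul_inv, norm_mul, norm_mul]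
  rw [show ((k + 1 : ℕ) : ℂ) + 1 + z = k + 2 + z by push_cast; ring] at h2
  have h3 : 2 / (((k + 1 : ℕ) : ℝ) + 1) ≤ 2 * (1 / √((k : ℝ) + 1)) := by
    rw [mul_one_div]
    gcongr
    rw [Real.sqrt_le_left (by positivity)]
    push_cast
    nlinarith
  calc _ ≤ 1 * (2 / ((k : ℝ) + 1) * (2 * (1 / √((k : ℝ) + 1)))) := by
        gcongr
        exact h2.trans h3
    _ = _ := by ring

/-- Summation by parts, accelerating the convergence of the shifted series. -/
lemma tailSum_shift_eq (hx : ‖x‖ ≤ 1 / 8) (hy : ‖y‖ ≤ 1 / 8) (N : ℕ) :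
    tailSum (x - (N + 1 : ℕ)) (y - (N + 1 : ℕ)) =
      (x - (N + 1 : ℕ)) / (x + y - 2 * (N + 1 : ℕ)) * (-1 / (1 + (x - y)) +
        ∑' k : ℕ, pochRatio (x - (N + 1 : ℕ) + 1) (1 - (y - (N + 1 : ℕ))) (k + 1) /
          ((k + 1 + (x - y)) * (k + 2 + (x - y)))) := by
  have hd : ‖x - y‖ ≤ 1 / 2 := by linarith [norm_sub_le x y]
  have sQ := summable_tailSum_shift hx hy (N + 1)
  have hb := one_sub_shift_ne_zero hy (N + 1)
  have hP := norm_pochRatio_shift_le_one hx hy N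
  have hs : x + y - 2 * (N + 1 : ℕ) ≠ 0 := by
    convert sum_sub_ne_zero hx hy (2 * N + 1) using 1; push_cast; ring
  rw [tailSum]
  have e : x - ((N + 1 : ℕ) : ℂ) - (y - (N + 1 : ℕ)) = x - y := by ring
  rw [e] at sQ ⊢
  clear e
  have es : x - ((N + 1 : ℕ) : ℂ) + 1 - (1 - (y - (N + 1 : ℕ))) = x + y - 2 * (N + 1 : ℕ) := by ring
  generalize x - ((N + 1 : ℕ) : ℂ) = a at *
  generalize 1 - (y - ((N + 1 : ℕ) : ℂ)) = b at *
  generalize x + y - 2 * ((N + 1 : ℕ) : ℂ) = s at *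
  generalize x - y = d at *
  have sR : Summable fun k : ℕ => pochRatio (a + 1) b (k + 1) / ((k + 1 + d) * (k + 2 + d)) :=
    Summable.of_norm_bounded (summable_one_div_sqrt_mul.mul_left 4)
      fun k => norm_div_mul_le hd (hP (k + 1)) k
  have hsum := (sQ.sub (sR.mul_left (a / s))).hasSum.tendsto_sum_nat
  have part : ∀ n, ∑ k ∈ Finset.range n, (pochRatio a b (k + 1) / (k + 1 + d) -
      a / s * (pochRatio (a + 1) b (k + 1) / ((k + 1 + d) * (k + 2 + d)))) =
      a / s * (pochRatio (a + 1) b n / (n + 1 + d) - 1 / (1 + d)) := by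
    intro n
    induction n with
    | zero => simp
    | succ n ih =>
      rw [Finset.sum_range_succ, ih, pochRatio_succ_mul hb, pochRatio_succ]
      have h1 := hb n
      have h2 := natCast_add_ne_zero hd n
      have h3 := natCast_add_ne_zero hd (n + 1)
      have h4 := natCast_add_ne_zero hd 0
      push_cast at h3 h4 ⊢
      rw [zero_add] at h4
      rw [show (n : ℂ) + 1 + 1 + d = n + 2 + d by ring] at *
      have ha : a = s + b - 1 := by rw [← es]; ring
      subst ha
      field_simp
      ring
  replace hsum := hsum.congr part
  have lim : Tendsto (fun n : ℕ => a / s * (pochRatio (a + 1) b n / (n + 1 + d) - 1 / (1 + d)))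
      atTop (𝓝 (a / s * (0 - 1 / (1 + d)))) := by
    refine Tendsto.const_mul _ (Tendsto.sub_const ?_ _)
    have h0 : Tendsto (fun n : ℕ => ‖((n : ℂ) + (1 + d))⁻¹‖) atTop (𝓝 0) := by
      simpa using (tendsto_inv_natCast_add (1 + d)).norm
    refine squeeze_zero_norm (fun n => ?_) h0
    rw [div_eq_mul_inv, norm_mul, add_assoc]
    exact mul_le_of_le_one_left (norm_nonneg _) (hP n)
  have := tendsto_nhds_unique hsum lim
  rw [sQ.tsum_sub (sR.mul_left _), tsum_mul_left, sub_eq_iff_eq_add] at this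
  rw [this]
  ring

/-- The limit of `tailSum (x - N) (y - N)`, which only depends on `x - y`. -/
lemma tendsto_tailSum_shift (hx : ‖x‖ ≤ 1 / 8) (hy : ‖y‖ ≤ 1 / 8) :
    Tendsto (fun N : ℕ => tailSum (x - (N + 1 : ℕ)) (y - (N + 1 : ℕ))) atTop
      (𝓝 (1 / 2 * (-1 / (1 + (x - y)) +
        ∑' k : ℕ, (-1) ^ (k + 1) / ((k + 1 + (x - y)) * (k + 2 + (x - y)))))) := by
  have hd : ‖x - y‖ ≤ 1 / 2 := by linarith [norm_sub_le x y]
  simp_rw [tailSum_shift_eq hx hy]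
  refine Tendsto.mul ?_ (Tendsto.const_add _ ?_)
  · have h1 : Tendsto (fun N : ℕ => 1 / 2 + (-(x - y) / 4) *
        (((N + 1 : ℕ) : ℂ) + (-(x + y) / 2))⁻¹) atTop (𝓝 (1 / 2)) := by
      simpa only [mul_zero, add_zero] using (((tendsto_add_atTop_iff_nat 1).2
        (tendsto_inv_natCast_add (-(x + y) / 2))).const_mul (-(x - y) / 4)).const_add (1 / 2)
    refine h1.congr fun N => ?_
    have hs : x + y - 2 * (N + 1 : ℕ) ≠ 0 := by
      convert sum_sub_ne_zero hx hy (2 * N + 1) using 1; push_cast; ring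
    have hs' : ((N + 1 : ℕ) : ℂ) + (-(x + y) / 2) ≠ 0 := by
      contrapose! hs
      linear_combination -2 * hs
    have hs2 : ((N + 1 : ℕ) : ℂ) + (-(x + y) / 2) = -(x + y - 2 * (N + 1 : ℕ)) / 2 := by ring
    rw [hs2]
    field_simp
    ring
  · refine tendsto_tsum_of_dominated_convergence (summable_one_div_sqrt_mul.mul_left 4)
      (fun k => ?_) (Eventually.of_forall fun N k =>
        norm_div_mul_le hd (norm_pochRatio_shift_le_one hx hy N (k + 1)) k)
    exact ((tendsto_add_atTop_iff_nat 1).2 (tendsto_pochRatio_shift x y (k + 1))).div_const _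

lemma tailSum_half {d : ℂ} (hd : ‖d‖ ≤ 1 / 4) :
    tailSum (d / 2) (-(d / 2)) = digammaSum (-(d / 2)) - digammaSum (-d) := by
  have hd2 : ‖d / 2‖ ≤ 1 / 8 := by rw [norm_div]; norm_num; linarith
  have hd3 : ‖-(d / 2)‖ ≤ 1 / 8 := by rwa [norm_neg]
  have hd4 : ‖-d‖ ≤ 1 / 2 := by rw [norm_neg]; linarith
  rw [tailSum, digammaSum, digammaSum, ← (summable_digammaSum (hd3.trans (by norm_num))).tsum_sub
    (summable_digammaSum hd4)]
  refine tsum_congr fun k => ?_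
  have := pochRatio_neg_one_sub hd3 k
  rw [neg_neg] at this
  rw [this]
  have h1 := natCast_add_ne_zero (hd2.trans (by norm_num)) k
  have h2 := natCast_add_ne_zero (z := d) (by linarith) k
  rw [sub_neg_eq_add, sub_neg_eq_add, sub_neg_eq_add, sub_sub_sub_cancel_right,
    add_halves, div_div, div_sub_div _ _ h1 h2, div_eq_div_iff (mul_ne_zero h1 h2) (mul_ne_zero h1 h2)]
  ring

/-- The antisymmetrization of `tailSum` only depends on `x - y`. -/
lemma tailSum_sub_tailSum (hx : ‖x‖ ≤ 1 / 8) (hy : ‖y‖ ≤ 1 / 8) :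
    tailSum x y - tailSum y x = digammaSum ((y - x) / 2) - digammaSum (y - x) -
      (digammaSum ((x - y) / 2) - digammaSum (x - y)) := by
  have lim : ∀ {x y : ℂ}, ‖x‖ ≤ 1 / 8 → ‖y‖ ≤ 1 / 8 →
      tailSum x y - tailSum y x = 1 / 2 * (-1 / (1 + (x - y)) +
        ∑' k : ℕ, (-1) ^ (k + 1) / ((k + 1 + (x - y)) * (k + 2 + (x - y)))) -
      1 / 2 * (-1 / (1 + -(x - y)) +
        ∑' k : ℕ, (-1) ^ (k + 1) / ((k + 1 + -(x - y)) * (k + 2 + -(x - y)))) := by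
    intro x y hx hy
    have h := (tendsto_tailSum_shift hx hy).sub (tendsto_tailSum_shift hy hx)
    simp_rw [← tailSum_sub_tailSum_shift hx hy, ← neg_sub x y] at h
    exact tendsto_nhds_unique tendsto_const_nhds h
  have hd : ‖x - y‖ ≤ 1 / 4 := by linarith [norm_sub_le x y]
  have hd2 : ‖(x - y) / 2‖ ≤ 1 / 8 := by rw [norm_div]; norm_num; linarith
  have h2 := lim hd2 (y := -((x - y) / 2)) (by rwa [norm_neg])
  rw [sub_neg_eq_add, add_halves, ← lim hx hy, tailSum_half hd] at h2
  have h3 := tailSum_half (d := -(x - y)) (by rwa [norm_neg])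
  rw [neg_div, neg_neg, neg_neg] at h3
  rw [← h2, h3, ← neg_div, neg_sub]

/-- The closed form of the antisymmetrized generating function. -/
theorem headSum_sub_headSum (hx : ‖x‖ ≤ 1 / 8) (hy : ‖y‖ ≤ 1 / 8) (hx0 : x ≠ 0) (hy0 : y ≠ 0) :
    headSum x y - headSum y x = y / x * (digammaSum y - digammaSum (y - x)) -
      x / y * (digammaSum x - digammaSum (x - y)) +
      (digammaSum ((y - x) / 2) - digammaSum (y - x) -
      (digammaSum ((x - y) / 2) - digammaSum (x - y))) := by
  rw [headSum_eq hx hy hx0, headSum_eq hy hx hy0, ← tailSum_sub_tailSum hx hy]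
  ring

end small

/-- Strictly decreasing `n`-tuples of positive integers bounded by `M`. -/
abbrev DecTuple (n M : ℕ) : Type :=
  {m : Fin n → ℕ // StrictAnti m ∧ (∀ i, 0 < m i) ∧ ∀ i, m i ≤ M}

/-- The multiple harmonic sum: the part of `mzv` whose indices are at most `M`. -/
noncomputable def truncMzv : (n : ℕ) → (Fin n → ℕ) → ℕ → ℝ
  | 0, _, _ => 1
  | n + 1, c, M => ∑ m ∈ Finset.range M, (((m : ℝ) + 1) ^ c 0)⁻¹ * truncMzv n (Fin.tail c) m

/-- Splitting off the largest entry of a strictly decreasing tuple. -/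
def decTupleConsEquiv (n : ℕ) (P : ℕ → Prop) :
    (Σ k : Subtype P, DecTuple n k) ≃
      {m : Fin (n + 1) → ℕ // StrictAnti m ∧ (∀ i, 0 < m i) ∧ P (m 0 - 1)} where
  toFun t := ⟨Fin.cons (t.1.1 + 1) t.2.1, by
    refine ⟨?_, ?_, by simpa using t.1.2⟩
    · intro i j hij
      refine Fin.cases (fun hij => ?_) (fun i hij => ?_) i hij
      · obtain ⟨j, rfl⟩ := Fin.exists_succ_eq.2 hij.ne'
        simpa using Nat.lt_succ_of_le (t.2.2.2.2 j)
      · obtain ⟨j, rfl⟩ := Fin.exists_succ_eq.2 (Fin.ne_zero_of_lt hij)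
        simpa using t.2.2.1 (Fin.succ_lt_succ_iff.1 hij)
    · exact Fin.cases (by simp) (fun i => by simpa using t.2.2.2.1 i)⟩
  invFun m := ⟨⟨m.1 0 - 1, m.2.2.2⟩, ⟨Fin.tail m.1,
    fun i j hij => m.2.1 (Fin.succ_lt_succ_iff.2 hij), fun i => m.2.2.1 _,
    fun i => Nat.le_sub_one_of_lt (m.2.1 (Fin.succ_pos i))⟩⟩
  left_inv t := by
    rcases t with ⟨⟨k, hk⟩, ⟨m, hm⟩⟩
    rfl
  right_inv m := by
    rcases m with ⟨m, hm⟩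
    have := hm.2.1 0
    simp only [Subtype.mk.injEq]
    rw [Nat.sub_add_cancel this, Fin.cons_self_tail]

lemma hasSum_decTuple_cons {n : ℕ} (P : ℕ → Prop) (c : Fin (n + 1) → ℕ) {a : ℝ}
    (ih : ∀ M, HasSum (fun m : DecTuple n M => ∏ i, ((m.1 i : ℝ) ^ Fin.tail c i)⁻¹)
      (truncMzv n (Fin.tail c) M))
    (h : HasSum (fun k : Subtype P => (((k : ℕ) + 1 : ℝ) ^ c 0)⁻¹ * truncMzv n (Fin.tail c) k) a) :
    HasSum (fun m : {m : Fin (n + 1) → ℕ // StrictAnti m ∧ (∀ i, 0 < m i) ∧ P (m 0 - 1)} =>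
      ∏ i, ((m.1 i : ℝ) ^ c i)⁻¹) a := by
  rw [← (decTupleConsEquiv n P).hasSum_iff]
  have hf : ∀ k : Subtype P, HasSum (fun m : DecTuple n k =>
      (((k : ℕ) + 1 : ℝ) ^ c 0)⁻¹ * ∏ i, ((m.1 i : ℝ) ^ Fin.tail c i)⁻¹)
      ((((k : ℕ) + 1 : ℝ) ^ c 0)⁻¹ * truncMzv n (Fin.tail c) k) := fun k => (ih k).mul_left _
  have e : ((fun m : {m : Fin (n + 1) → ℕ // StrictAnti m ∧ (∀ i, 0 < m i) ∧ P (m 0 - 1)} =>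
      ∏ i, ((m.1 i : ℝ) ^ c i)⁻¹) ∘ decTupleConsEquiv n P) = fun t =>
      (((t.1 : ℕ) + 1 : ℝ) ^ c 0)⁻¹ * ∏ i, ((t.2.1 i : ℝ) ^ Fin.tail c i)⁻¹ := by
    funext t
    simp [decTupleConsEquiv, Fin.prod_univ_succ, Fin.tail]
    ring
  rw [e]
  refine h.sigma_of_hasSum hf ((summable_sigma_of_nonneg fun t => ?_).2
    ⟨fun k => (hf k).summable, ?_⟩)
  · positivity
  · exact h.summable.congr fun k => (hf k).tsum_eq.symm

lemma hasSum_truncMzv (n : ℕ) (c : Fin n → ℕ) (M : ℕ) :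
    HasSum (fun m : DecTuple n M => ∏ i, ((m.1 i : ℝ) ^ c i)⁻¹) (truncMzv n c M) := by
  induction n generalizing M with
  | zero =>
    have : Unique (DecTuple 0 M) :=
      { default := ⟨Fin.elim0, fun i => i.elim0, fun i => i.elim0, fun i => i.elim0⟩
        uniq := fun m => Subtype.ext (funext fun i => i.elim0) }
    simpa only [truncMzv, Finset.univ_eq_empty, Finset.prod_empty] using
      hasSum_unique (fun m : DecTuple 0 M => ∏ i, ((m.1 i : ℝ) ^ c i)⁻¹)
  | succ n ih =>
    have h : HasSum (fun k : {k : ℕ // k ∈ Finset.range M} =>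
        (((k : ℕ) + 1 : ℝ) ^ c 0)⁻¹ * truncMzv n (Fin.tail c) k) (truncMzv (n + 1) c M) := by
      rw [truncMzv, ← Finset.sum_coe_sort]
      exact hasSum_fintype _
    have h2 := hasSum_decTuple_cons _ c (ih (Fin.tail c)) h
    rw [← (Equiv.subtypeEquivRight fun m => ?_).hasSum_iff] at h2
    · exact h2
    · refine and_congr_right fun h1 => and_congr_right fun h2 => ?_
      have := h2 0
      rw [Finset.mem_range]
      constructor
      · intro h
        have := h 0
        omega
      · intro h i
        have := h1.antitone (Fin.zero_le i)
        omega

lemma mzv_eq_tsum {n : ℕ} {c : Fin (n + 1) → ℕ}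
    (h : Summable fun k : ℕ => (((k : ℕ) + 1 : ℝ) ^ c 0)⁻¹ * truncMzv n (Fin.tail c) k) :
    HasSum (fun k : ℕ => (((k : ℕ) + 1 : ℝ) ^ c 0)⁻¹ * truncMzv n (Fin.tail c) k) (mzv c) := by
  have h1 : HasSum (fun k : Subtype fun _ : ℕ => True =>
      (((k : ℕ) + 1 : ℝ) ^ c 0)⁻¹ * truncMzv n (Fin.tail c) k)
      (∑' k : ℕ, (((k : ℕ) + 1 : ℝ) ^ c 0)⁻¹ * truncMzv n (Fin.tail c) k) := by
    rw [← (Equiv.subtypeUnivEquiv fun _ => trivial).symm.hasSum_iff]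
    exact h.hasSum
  have h2 := hasSum_decTuple_cons _ c (hasSum_truncMzv n (Fin.tail c)) h1
  rw [← (Equiv.subtypeEquivRight fun m => by simp : {m : Fin (n + 1) → ℕ //
    StrictAnti m ∧ ∀ i, 0 < m i} ≃ _).hasSum_iff] at h2
  have h3 : mzv c = _ := h2.tsum_eq
  rw [h3]
  exact h.hasSum

/-- The products controlling all multiple harmonic sums grow at most like a square root. -/
lemma prod_one_add_le_sqrt (M : ℕ) :
    ∏ j ∈ Finset.range M, (1 + 1 / 4 / ((j : ℝ) + 1 - 1 / 8)) ≤ √((M : ℝ) + 1) := by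
  induction M with
  | zero => simp
  | succ M ih =>
    rw [Finset.prod_range_succ]
    have hM : (0 : ℝ) ≤ M := by positivity
    have h8 : (0 : ℝ) < M + 1 - 1 / 8 := by linarith
    have h1 : 1 + 1 / 4 / ((M : ℝ) + 1 - 1 / 8) ≤ √((M + 2) / (M + 1)) := by
      refine Real.le_sqrt_of_sq_le ?_
      rw [le_div_iff₀ (by positivity), one_add_div h8.ne', div_pow, div_mul_eq_mul_div,
        div_le_iff₀ (by positivity)]
      nlinarith
    calc _ ≤ √((M : ℝ) + 1) * √((M + 2) / (M + 1)) :=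
          mul_le_mul ih h1 (by positivity) (by positivity)
      _ = _ := by
        rw [← Real.sqrt_mul (by positivity)]
        congr 1
        push_cast
        field_simp
        ring

lemma truncMzv_nonneg (n : ℕ) (c : Fin n → ℕ) (M : ℕ) : 0 ≤ truncMzv n c M := by
  induction n generalizing M with
  | zero => simp [truncMzv]
  | succ n ih => exact Finset.sum_nonneg fun m _ => mul_nonneg (by positivity) (ih _ _)

lemma truncMzv_le {n : ℕ} {c : Fin n → ℕ} (hc : ∀ i, 1 ≤ c i) (M : ℕ) :
    truncMzv n c M ≤ 4 ^ n * √((M : ℝ) + 1) := by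
  refine le_trans ?_ (mul_le_mul_of_nonneg_left (prod_one_add_le_sqrt M) (by positivity))
  have hpos : ∀ j : ℕ, (0 : ℝ) < j + 1 - 1 / 8 := fun j => by
    linarith [(by positivity : (0 : ℝ) ≤ j)]
  have hP : ∀ M : ℕ, 0 ≤ ∏ j ∈ Finset.range M, (1 + 1 / 4 / ((j : ℝ) + 1 - 1 / 8)) := fun M =>
    Finset.prod_nonneg fun j _ => add_nonneg zero_le_one (div_nonneg (by norm_num) (hpos j).le)
  induction n generalizing M with
  | zero =>
    simp only [truncMzv, pow_zero, one_mul]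
    refine Finset.one_le_prod fun j _ => ?_
    have := (hpos j).le
    have : 0 ≤ 1 / 4 / ((j : ℝ) + 1 - 1 / 8) := by positivity
    linarith
  | succ n ih =>
    induction M with
    | zero => simp [truncMzv]
    | succ M ihM =>
      rw [truncMzv, Finset.sum_range_succ, Finset.prod_range_succ, mul_add, mul_add, mul_one]
      rw [truncMzv] at ihM
      refine add_le_add ihM ?_
      have h1 : (((M : ℝ) + 1) ^ c 0)⁻¹ ≤ 1 / ((M : ℝ) + 1 - 1 / 8) := by
        rw [← one_div]
        refine one_div_le_one_div_of_le (hpos M) ?_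
        calc (M : ℝ) + 1 - 1 / 8 ≤ ((M : ℝ) + 1) ^ 1 := by linarith
          _ ≤ _ := pow_le_pow_right₀ (by linarith [(by positivity : (0 : ℝ) ≤ M)]) (hc 0)
      calc _ ≤ 1 / ((M : ℝ) + 1 - 1 / 8) *
            (4 ^ n * ∏ j ∈ Finset.range M, (1 + 1 / 4 / ((j : ℝ) + 1 - 1 / 8))) :=
            mul_le_mul h1 (ih (fun i => hc _) M) (truncMzv_nonneg _ _ _)
              (div_nonneg zero_le_one (hpos M).le)
        _ = _ := by ring

lemma hasSum_mzv {n : ℕ} {c : Fin (n + 1) → ℕ} (h0 : 2 ≤ c 0) (hc : ∀ i, 1 ≤ c i) :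
    HasSum (fun k : ℕ => (((k : ℕ) + 1 : ℝ) ^ c 0)⁻¹ * truncMzv n (Fin.tail c) k) (mzv c) := by
  refine mzv_eq_tsum (Summable.of_nonneg_of_le
    (fun k => mul_nonneg (by positivity) (truncMzv_nonneg _ _ _)) (fun k => ?_)
    (summable_one_div_sqrt_mul.mul_left (4 ^ n)))
  have h1 : (((k : ℝ) + 1) ^ c 0)⁻¹ ≤ (((k : ℝ) + 1) ^ 2)⁻¹ := by
    gcongr
    linarith [(by positivity : (0 : ℝ) ≤ k)]
  calc _ ≤ (((k : ℝ) + 1) ^ 2)⁻¹ * (4 ^ n * √((k : ℝ) + 1)) :=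
        mul_le_mul h1 (truncMzv_le (fun i => hc _) k) (truncMzv_nonneg _ _ _) (by positivity)
    _ = _ := by
      have := Real.mul_self_sqrt (by positivity : 0 ≤ (k : ℝ) + 1)
      have h0 : √((k : ℝ) + 1) ≠ 0 := by positivity
      have h2 : (k : ℝ) + 1 ≠ 0 := by positivity
      field_simp
      rw [sq, this]

lemma sum_antidiagonalTuple_succ {R : Type*} [AddCommMonoid R] (n r : ℕ)
    (f : (Fin (n + 1) → ℕ) → R) :
    ∑ c ∈ Finset.Nat.antidiagonalTuple (n + 1) r, f c =
      ∑ p ∈ Finset.HasAntidiagonal.antidiagonal r, ∑ c ∈ Finset.Nat.antidiagonalTuple n p.2,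
        f (Fin.cons p.1 c) := by
  rw [Finset.sum_sigma']
  refine Finset.sum_bij' (fun c _ => ⟨(c 0, ∑ i, Fin.tail c i), Fin.tail c⟩)
    (fun t _ => Fin.cons t.1.1 t.2) ?_ ?_ ?_ ?_ ?_
  · intro c hc
    rw [Finset.Nat.mem_antidiagonalTuple, Fin.sum_univ_succ] at hc
    simp [Finset.Nat.mem_antidiagonalTuple, Fin.tail, hc]
  · rintro ⟨⟨a, b⟩, c⟩ h
    simp only [Finset.mem_sigma, Finset.HasAntidiagonal.mem_antidiagonal, Finset.Nat.mem_antidiagonalTuple] at h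
    simp [Finset.Nat.mem_antidiagonalTuple, Fin.sum_univ_succ, h]
  · intro c _
    simp
  · rintro ⟨⟨a, b⟩, c⟩ h
    simp only [Finset.mem_sigma, Finset.HasAntidiagonal.mem_antidiagonal, Finset.Nat.mem_antidiagonalTuple] at h
    simp [h.2]
  · intro c _
    simp

lemma hasSum_sum_antidiagonal_mul {𝕜 : Type*} [RCLike 𝕜] {f g : ℕ → 𝕜} {a b : 𝕜}
    (hf : HasSum f a) (hg : HasSum g b) :
    HasSum (fun n => ∑ p ∈ Finset.HasAntidiagonal.antidiagonal n, f p.1 * g p.2) (a * b) := by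
  have hf' := summable_norm_iff.2 hf.summable
  have hg' := summable_norm_iff.2 hg.summable
  rw [← hf.tsum_eq, ← hg.tsum_eq,
    tsum_mul_tsum_eq_tsum_sum_antidiagonal_of_summable_norm hf' hg']
  exact (summable_norm_sum_mul_antidiagonal_of_summable_norm hf' hg').of_norm.hasSum

section generating
variable {𝕜 : Type*} [RCLike 𝕜]

/-- The `a`-th coefficient of the expansion of `1 / (j - y)` with total degree recorded by `a`. -/
def tailWeight (y : 𝕜) (a : ℕ) : 𝕜 := if a = 0 then 0 else y ^ (a - 1)

/-- The weight of the leading entry, which has to be at least two. -/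
def headWeight (x : 𝕜) (a : ℕ) : 𝕜 := if 2 ≤ a then x ^ (a - 1) else 0

/-- The part of weight `r` in the expansion of `∏ j ∈ range M, (1 + w / (j + 1 - y))`. -/
def genCoeff (w y : 𝕜) : ℕ → ℕ → 𝕜
  | 0, r => if r = 0 then 1 else 0
  | M + 1, r => genCoeff w y M r + w * ∑ p ∈ Finset.HasAntidiagonal.antidiagonal r,
      tailWeight y p.1 * (((M : 𝕜) + 1) ^ p.1)⁻¹ * genCoeff w y M p.2

lemma natCast_add_one_norm (M : ℕ) : ‖((M : 𝕜) + 1)‖ = (M : ℝ) + 1 := by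
  rw [← Nat.cast_succ, RCLike.norm_natCast, Nat.cast_succ]

lemma hasSum_tailWeight {y : 𝕜} (hy : ‖y‖ < 1) (M : ℕ) :
    HasSum (fun a => tailWeight y a * (((M : 𝕜) + 1) ^ a)⁻¹) (1 / ((M : 𝕜) + 1 - y)) := by
  have hM : (M : 𝕜) + 1 ≠ 0 := Nat.cast_add_one_ne_zero M
  have hlt : ‖y / ((M : 𝕜) + 1)‖ < 1 := by
    rw [norm_div, natCast_add_one_norm, div_lt_one (by positivity)]
    exact hy.trans_le (by simp)
  have hne : (M : 𝕜) + 1 - y ≠ 0 := fun h => by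
    rw [← sub_eq_zero.1 h, div_self hM, norm_one] at hlt
    exact lt_irrefl _ hlt
  have h := (hasSum_geometric_of_norm_lt_one hlt).mul_right ((M : 𝕜) + 1)⁻¹
  have hval : 1 / ((M : 𝕜) + 1 - y) -
      ∑ a ∈ Finset.range 1, tailWeight y a * (((M : 𝕜) + 1) ^ a)⁻¹ =
      (1 - y / ((M : 𝕜) + 1))⁻¹ * ((M : 𝕜) + 1)⁻¹ := by
    rw [Finset.sum_range_one, tailWeight, if_pos rfl]
    field_simp
    simp
  rw [← hasSum_nat_add_iff' 1, hval]
  refine h.congr_fun fun a => ?_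
  rw [tailWeight, if_neg (by omega), Nat.add_sub_cancel, div_pow, pow_succ]
  field_simp

lemma hasSum_headWeight {x : 𝕜} (hx : ‖x‖ < 1) (M : ℕ) :
    HasSum (fun a => headWeight x a * (((M : 𝕜) + 1) ^ a)⁻¹)
      (1 / ((M : 𝕜) + 1 - x) - 1 / ((M : 𝕜) + 1)) := by
  have h := (hasSum_tailWeight hx M).sub (hasSum_ite_eq 1 (1 / ((M : 𝕜) + 1)))
  refine h.congr_fun fun a => ?_
  rcases a with _ | _ | a <;> simp [headWeight, tailWeight]

lemma hasSum_genCoeff (w : 𝕜) {y : 𝕜} (hy : ‖y‖ < 1) (M : ℕ) :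
    HasSum (genCoeff w y M) (∏ j ∈ Finset.range M, (1 + w / ((j : 𝕜) + 1 - y))) := by
  induction M with
  | zero =>
    rw [Finset.prod_range_zero]
    exact hasSum_ite_eq 0 1
  | succ M ih =>
    rw [Finset.prod_range_succ, mul_add, mul_one,
      show ∀ P : 𝕜, P * (w / ((M : 𝕜) + 1 - y)) = w * (1 / ((M : 𝕜) + 1 - y) * P) from
        fun P => by ring]
    exact ih.add ((hasSum_sum_antidiagonal_mul (hasSum_tailWeight hy M) ih).mul_left w)

lemma hasSum_headWeight_mul_genCoeff (w : 𝕜) {x y : 𝕜} (hx : ‖x‖ < 1) (hy : ‖y‖ < 1) (M : ℕ) :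
    HasSum (fun l => ∑ p ∈ Finset.HasAntidiagonal.antidiagonal l,
        headWeight x p.1 * (((M : 𝕜) + 1) ^ p.1)⁻¹ * genCoeff w y M p.2)
      ((1 / ((M : 𝕜) + 1 - x) - 1 / ((M : 𝕜) + 1)) *
        ∏ j ∈ Finset.range M, (1 + w / ((j : 𝕜) + 1 - y))) :=
  hasSum_sum_antidiagonal_mul (f := fun a => headWeight x a * (((M : 𝕜) + 1) ^ a)⁻¹)
    (hasSum_headWeight hx M) (hasSum_genCoeff w hy M)

lemma norm_tailWeight (y : 𝕜) (a : ℕ) : ‖tailWeight y a‖ = tailWeight ‖y‖ a := by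
  unfold tailWeight
  split_ifs <;> simp

lemma norm_headWeight (x : 𝕜) (a : ℕ) : ‖headWeight x a‖ = headWeight ‖x‖ a := by
  unfold headWeight
  split_ifs <;> simp

lemma norm_genCoeff_le (w y : 𝕜) (M r : ℕ) : ‖genCoeff w y M r‖ ≤ genCoeff ‖w‖ ‖y‖ M r := by
  induction M generalizing r with
  | zero =>
    unfold genCoeff
    split_ifs <;> simp
  | succ M ih =>
    rw [genCoeff, genCoeff]
    refine (norm_add_le _ _).trans (add_le_add (ih r) ?_)
    rw [norm_mul]
    refine mul_le_mul_of_nonneg_left ((norm_sum_le _ _).trans (Finset.sum_le_sum fun p _ => ?_))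
      (norm_nonneg _)
    rw [norm_mul, norm_mul, norm_inv, norm_pow, natCast_add_one_norm, norm_tailWeight]
    refine mul_le_mul_of_nonneg_left (ih _) (mul_nonneg ?_ (by positivity))
    rw [← norm_tailWeight]
    exact norm_nonneg _

lemma norm_sum_headWeight_mul_genCoeff_le (w x y : 𝕜) (M l : ℕ) :
    ‖∑ p ∈ Finset.HasAntidiagonal.antidiagonal l,
        headWeight x p.1 * (((M : 𝕜) + 1) ^ p.1)⁻¹ * genCoeff w y M p.2‖ ≤
      ∑ p ∈ Finset.HasAntidiagonal.antidiagonal l,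
        headWeight ‖x‖ p.1 * (((M : ℝ) + 1) ^ p.1)⁻¹ * genCoeff ‖w‖ ‖y‖ M p.2 := by
  refine (norm_sum_le _ _).trans (Finset.sum_le_sum fun p _ => ?_)
  rw [norm_mul, norm_mul, norm_inv, norm_pow, natCast_add_one_norm, norm_headWeight]
  refine mul_le_mul_of_nonneg_left (norm_genCoeff_le _ _ _ _) (mul_nonneg ?_ (by positivity))
  rw [← norm_headWeight]
  exact norm_nonneg _

end generating

/-- For small parameters the whole family of generating coefficients is summable. -/
lemma summable_headWeight_mul_genCoeff {w x y : ℂ} (hw : ‖w‖ ≤ 1 / 4) (hx : ‖x‖ ≤ 1 / 4)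
    (hy : ‖y‖ ≤ 1 / 8) :
    Summable fun q : ℕ × ℕ => ∑ p ∈ Finset.HasAntidiagonal.antidiagonal q.2,
      headWeight x p.1 * (((q.1 : ℂ) + 1) ^ p.1)⁻¹ * genCoeff w y q.1 p.2 := by
  have hx1 : ‖(‖x‖ : ℝ)‖ < 1 := by rw [norm_norm]; linarith
  have hy1 : ‖(‖y‖ : ℝ)‖ < 1 := by rw [norm_norm]; linarith
  have h := hasSum_headWeight_mul_genCoeff (𝕜 := ℝ) ‖w‖ hx1 hy1
  refine Summable.of_norm_bounded (g := fun q : ℕ × ℕ =>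
    ∑ p ∈ Finset.HasAntidiagonal.antidiagonal q.2,
      headWeight ‖x‖ p.1 * (((q.1 : ℝ) + 1) ^ p.1)⁻¹ * genCoeff ‖w‖ ‖y‖ q.1 p.2) ?_
    fun q => norm_sum_headWeight_mul_genCoeff_le w x y q.1 q.2
  refine (summable_prod_of_nonneg fun q =>
    (norm_nonneg _).trans (norm_sum_headWeight_mul_genCoeff_le w x y q.1 q.2)).2
    ⟨fun M => (h M).summable, ?_⟩
  simp only [fun M => (h M).tsum_eq]
  have hpos : ∀ j : ℕ, (0 : ℝ) < j + 1 - 1 / 8 := fun j => by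
    linarith [(by positivity : (0 : ℝ) ≤ j)]
  have hpos' : ∀ j : ℕ, (0 : ℝ) < j + 1 - ‖y‖ := fun j => by
    linarith [hpos j]
  have hprod0 : ∀ M : ℕ, 0 ≤ ∏ j ∈ Finset.range M, (1 + ‖w‖ / ((j : ℝ) + 1 - ‖y‖)) := fun M =>
    Finset.prod_nonneg fun j _ =>
      add_nonneg zero_le_one (div_nonneg (norm_nonneg _) (hpos' j).le)
  have hprod : ∀ M : ℕ, ∏ j ∈ Finset.range M, (1 + ‖w‖ / ((j : ℝ) + 1 - ‖y‖)) ≤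
      √((M : ℝ) + 1) := fun M => by
    refine le_trans (Finset.prod_le_prod (fun j _ => ?_) fun j _ => ?_) (prod_one_add_le_sqrt M)
    · exact add_nonneg zero_le_one (div_nonneg (norm_nonneg _) (hpos' j).le)
    · have := div_le_div₀ (by norm_num) hw (hpos j) (by linarith : (j : ℝ) + 1 - 1 / 8 ≤ j + 1 - ‖y‖)
      linarith
  have hhead : ∀ M : ℕ, 1 / ((M : ℝ) + 1 - ‖x‖) - 1 / ((M : ℝ) + 1) ∈
      Set.Icc 0 (1 / ((M : ℝ) + 1) ^ 2) := fun M => by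
    have hM : (0 : ℝ) ≤ M := by positivity
    have h1 : (0 : ℝ) < M + 1 - ‖x‖ := by linarith
    have h0 := norm_nonneg x
    rw [div_sub_div _ _ h1.ne' (by positivity)]
    constructor
    · exact div_nonneg (by linarith) (by positivity)
    · rw [div_le_div_iff₀ (by positivity) (by positivity)]
      nlinarith
  refine Summable.of_nonneg_of_le (fun M => mul_nonneg (hhead M).1 (hprod0 M)) (fun M => ?_)
    summable_one_div_sqrt_mul
  calc _ ≤ 1 / ((M : ℝ) + 1) ^ 2 * √((M : ℝ) + 1) :=
        mul_le_mul (hhead M).2 (hprod M) (hprod0 M) (by positivity)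
    _ = _ := by
      have := Real.mul_self_sqrt (by positivity : 0 ≤ (M : ℝ) + 1)
      have h0 : √((M : ℝ) + 1) ≠ 0 := by positivity
      have h2 : (M : ℝ) + 1 ≠ 0 := by positivity
      field_simp
      rw [sq, this]

/-- The part of depth `n` and weight `r` in the generating coefficient, cut off at `M`. -/
noncomputable def depthCoeff (y : ℂ) (n r M : ℕ) : ℂ :=
  ∑ c ∈ Finset.Nat.antidiagonalTuple n r, (∏ i, tailWeight y (c i)) * (truncMzv n c M : ℂ)

lemma depthCoeff_zero (y : ℂ) (r M : ℕ) : depthCoeff y 0 r M = if r = 0 then 1 else 0 := by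
  rcases r with _ | r <;> simp [depthCoeff, truncMzv]

lemma depthCoeff_succ (y : ℂ) (n r M : ℕ) :
    depthCoeff y (n + 1) r M = ∑ m ∈ Finset.range M,
      ∑ p ∈ Finset.HasAntidiagonal.antidiagonal r,
        tailWeight y p.1 * (((m : ℂ) + 1) ^ p.1)⁻¹ * depthCoeff y n p.2 m := by
  rw [depthCoeff, sum_antidiagonalTuple_succ, Finset.sum_comm]
  refine Finset.sum_congr rfl fun p _ => ?_
  simp only [depthCoeff, Finset.mul_sum]
  rw [Finset.sum_comm]
  refine Finset.sum_congr rfl fun c _ => ?_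
  simp only [truncMzv, Fin.prod_univ_succ, Fin.cons_zero, Fin.cons_succ, Fin.tail_cons]
  push_cast
  rw [Finset.mul_sum]
  refine Finset.sum_congr rfl fun m _ => ?_
  ring

lemma sum_depthCoeff (w y : ℂ) (M : ℕ) {L r : ℕ} (h : r < L) :
    ∑ n ∈ Finset.range L, w ^ n * depthCoeff y n r M = genCoeff w y M r := by
  induction M generalizing L r with
  | zero =>
    obtain ⟨L, rfl⟩ := Nat.exists_eq_add_one_of_ne_zero (Nat.ne_zero_of_lt h)
    rw [Finset.sum_range_succ']
    simp [depthCoeff_succ, depthCoeff_zero, genCoeff]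
  | succ M ih =>
    rw [genCoeff, ← ih h]
    obtain ⟨L, rfl⟩ := Nat.exists_eq_add_one_of_ne_zero (Nat.ne_zero_of_lt h)
    simp only [Finset.sum_range_succ' _ L, depthCoeff_succ _ _ _ (M + 1),
      Finset.sum_range_succ _ M, ← depthCoeff_succ, depthCoeff_zero, mul_add,
      Finset.sum_add_distrib]
    have hsum : ∑ n ∈ Finset.range L, w ^ (n + 1) *
        ∑ p ∈ Finset.HasAntidiagonal.antidiagonal r,
          tailWeight y p.1 * (((M : ℂ) + 1) ^ p.1)⁻¹ * depthCoeff y n p.2 M =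
        w * ∑ p ∈ Finset.HasAntidiagonal.antidiagonal r,
          tailWeight y p.1 * (((M : ℂ) + 1) ^ p.1)⁻¹ * genCoeff w y M p.2 := by
      simp only [Finset.mul_sum]
      rw [Finset.sum_comm]
      refine Finset.sum_congr rfl fun p hp => ?_
      rw [Finset.HasAntidiagonal.mem_antidiagonal] at hp
      rcases Nat.eq_zero_or_pos p.1 with h0 | h0
      · simp [tailWeight, h0]
      · rw [← ih (show p.2 < L by omega), Finset.mul_sum, Finset.mul_sum]
        refine Finset.sum_congr rfl fun n _ => ?_
        ring
    rw [hsum]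
    ring

lemma G_eq_sum (l k : ℕ) (x y : ℂ) :
    G l (k + 1) x y = ∑ c ∈ Finset.Nat.antidiagonalTuple (k + 1) l,
      headWeight x (c 0) * (∏ i : Fin k, tailWeight y (c i.succ)) * (mzv c : ℂ) := by
  rw [G, Finset.sum_filter]
  refine Finset.sum_congr rfl fun c hc => ?_
  rw [Finset.Nat.mem_antidiagonalTuple, Fin.sum_univ_succ] at hc
  split_ifs with h
  · have e : ∑ i : Fin k, (c i.succ - 1) = l - c 0 - k := by
      have : ∑ i : Fin k, (c i.succ - 1) + ∑ _i : Fin k, 1 = ∑ i : Fin k, c i.succ := by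
        rw [← Finset.sum_add_distrib]
        exact Finset.sum_congr rfl fun i _ => Nat.sub_add_cancel (h.2 _)
      simp only [Finset.sum_const, Finset.card_univ, Fintype.card_fin, smul_eq_mul,
        mul_one] at this
      omega
    rw [headWeight, if_pos h.1, ← e, ← Finset.prod_pow_eq_pow_sum]
    congr 2
    refine Finset.prod_congr rfl fun i _ => ?_
    rw [tailWeight, if_neg (Nat.one_le_iff_ne_zero.1 (h.2 _))]
  · by_cases h0 : 2 ≤ c 0
    · simp only [h0, true_and, not_forall, not_le, Nat.lt_one_iff] at h
      obtain ⟨i, hi⟩ := h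
      obtain ⟨i, rfl⟩ := Fin.exists_succ_eq.2 (show i ≠ 0 by rintro rfl; omega)
      rw [Finset.prod_eq_zero (Finset.mem_univ i) (by rw [tailWeight, if_pos hi])]
      simp
    · simp [headWeight, h0]

lemma hasSum_G (l k : ℕ) (x y : ℂ) :
    HasSum (fun m : ℕ => ∑ p ∈ Finset.HasAntidiagonal.antidiagonal l,
      headWeight x p.1 * (((m : ℂ) + 1) ^ p.1)⁻¹ * depthCoeff y k p.2 m) (G l (k + 1) x y) := by
  rw [G_eq_sum, sum_antidiagonalTuple_succ]
  simp only [depthCoeff, Finset.mul_sum]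
  refine hasSum_sum fun p _ => hasSum_sum fun c _ => ?_
  simp only [Fin.cons_zero, Fin.cons_succ]
  by_cases h : 2 ≤ p.1 ∧ ∀ i, 1 ≤ c i
  · have h1 := hasSum_mzv (c := (Fin.cons p.1 c : Fin (k + 1) → ℕ)) h.1
      (Fin.cases (by simpa using one_le_two.trans h.1) (by simpa using h.2))
    have h2 := (Complex.hasSum_ofReal.2 h1).mul_left
      (headWeight x p.1 * ∏ i, tailWeight y (c i))
    refine h2.congr_fun fun m => ?_
    simp only [Fin.cons_zero, Fin.tail_cons]
    push_cast
    ring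
  · have h0 : headWeight x p.1 * ∏ i, tailWeight y (c i) = 0 := by
      by_cases h2 : 2 ≤ p.1
      · simp only [h2, true_and, not_forall, not_le, Nat.lt_one_iff] at h
        obtain ⟨i, hi⟩ := h
        rw [Finset.prod_eq_zero (Finset.mem_univ i) (by rw [tailWeight, if_pos hi]), mul_zero]
      · simp [headWeight, h2]
    rw [h0, zero_mul]
    refine hasSum_zero.congr_fun fun m => ?_
    linear_combination (((m : ℂ) + 1) ^ p.1)⁻¹ * (truncMzv k c m : ℂ) * h0

/-- The sum of all the `G l n x y`, weighted by powers of `w`. -/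
noncomputable def depthSum (l : ℕ) (w x y : ℂ) : ℂ :=
  ∑ k ∈ Finset.range l, w ^ k * G l (k + 1) x y

lemma hasSum_depthSum (l : ℕ) (w x y : ℂ) :
    HasSum (fun m : ℕ => ∑ p ∈ Finset.HasAntidiagonal.antidiagonal l,
      headWeight x p.1 * (((m : ℂ) + 1) ^ p.1)⁻¹ * genCoeff w y m p.2) (depthSum l w x y) := by
  refine (hasSum_sum fun k _ => (hasSum_G l k x y).mul_left (w ^ k)).congr_fun fun m => ?_
  simp only [Finset.mul_sum]
  rw [Finset.sum_comm]
  refine Finset.sum_congr rfl fun p hp => ?_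
  rw [Finset.HasAntidiagonal.mem_antidiagonal] at hp
  by_cases h : 2 ≤ p.1
  · rw [← sum_depthCoeff w y m (show p.2 < l by omega), Finset.mul_sum]
    refine Finset.sum_congr rfl fun n _ => ?_
    ring
  · simp [headWeight, h]

lemma hasSum_depthSum_eq_tsum {w x y : ℂ} (hw : ‖w‖ ≤ 1 / 4) (hx : ‖x‖ ≤ 1 / 4)
    (hy : ‖y‖ ≤ 1 / 8) :
    HasSum (fun l => depthSum l w x y) (∑' m : ℕ, (1 / ((m : ℂ) + 1 - x) - 1 / ((m : ℂ) + 1)) *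
      ∏ j ∈ Finset.range m, (1 + w / ((j : ℂ) + 1 - y))) := by
  have hs := summable_headWeight_mul_genCoeff hw hx hy
  have h1 := hs.hasSum.prod_fiberwise fun m =>
    hasSum_headWeight_mul_genCoeff w (by linarith) (by linarith) m
  rw [h1.tsum_eq]
  exact ((Equiv.prodComm ℕ ℕ).hasSum_iff.2 hs.hasSum).prod_fiberwise fun l =>
    hasSum_depthSum l w x y

lemma hasSum_depthSum_eq_headSum {x y : ℂ} (hx : ‖x‖ ≤ 1 / 8) (hy : ‖y‖ ≤ 1 / 8) :
    HasSum (fun l => depthSum l (y - x) (x + y) y) (headSum x y) := by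
  convert hasSum_depthSum_eq_tsum (w := y - x) (x := x + y)
    ((norm_sub_le _ _).trans (by linarith)) ((norm_add_le _ _).trans (by linarith)) hy using 1
  refine tsum_congr fun m => ?_
  rw [mul_comm, pochRatio]
  congr 1
  refine Finset.prod_congr rfl fun j _ => ?_
  have hne : (j : ℂ) + 1 - y ≠ 0 := by
    rw [sub_eq_add_neg]
    exact natCast_add_ne_zero (by rw [norm_neg]; linarith) j
  rw [show 1 - y + (j : ℂ) = j + 1 - y by ring]
  field_simp
  ring

lemma G_one (l : ℕ) (x y : ℂ) : G l 1 x y = headWeight x l * (rz l : ℂ) := by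
  have hrz : (rz l : ℂ) = ∑' m : ℕ, (((m : ℂ) + 1) ^ l)⁻¹ := by
    rw [rz, tsum_pnat_eq_tsum_succ (f := fun m : ℕ => ((m : ℝ) ^ l)⁻¹), Complex.ofReal_tsum]
    push_cast
    rfl
  rw [hrz, ← tsum_mul_left, ← (hasSum_G l 0 x y).tsum_eq]
  refine tsum_congr fun m => ?_
  rw [Finset.sum_eq_single (l, 0)]
  · simp [depthCoeff_zero]
  · rintro ⟨a, b⟩ hp hne
    rw [Finset.HasAntidiagonal.mem_antidiagonal] at hp
    have hb : b ≠ 0 := by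
      rintro rfl
      exact hne (by simpa using hp)
    simp [depthCoeff_zero, hb]
  · intro h
    simp at h

lemma hasSum_headWeight_mul_rz {z : ℂ} (hz : ‖z‖ ≤ 1 / 4) :
    HasSum (fun l => headWeight z l * (rz l : ℂ)) (digammaSum z) := by
  convert hasSum_depthSum_eq_tsum (w := 0) (x := z) (y := 0) (by simp) hz (by simp) using 1
  · funext l
    rcases l with _ | l
    · simp [headWeight, depthSum]
    · rw [depthSum, Finset.sum_range_succ', Finset.sum_eq_zero fun k _ => by simp]
      simp [G_one]
  · simp [digammaSum]

lemma mul_headWeight_mul (t x : ℂ) (a : ℕ) :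
    t * headWeight (t * x) a = t ^ a * headWeight x a := by
  rcases a with _ | a
  · simp [headWeight]
  · unfold headWeight
    split_ifs
    · rw [Nat.add_sub_cancel, mul_pow, pow_succ]
      ring
    · simp

lemma mul_tailWeight_mul (t y : ℂ) (a : ℕ) :
    t * tailWeight (t * y) a = t ^ a * tailWeight y a := by
  rcases a with _ | a
  · simp [tailWeight]
  · rw [tailWeight, tailWeight, if_neg (by omega), if_neg (by omega), Nat.add_sub_cancel, mul_pow,
      pow_succ]
    ring

lemma genCoeff_mul (t w y : ℂ) (M r : ℕ) :
    genCoeff (t * w) (t * y) M r = t ^ r * genCoeff w y M r := by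
  induction M generalizing r with
  | zero =>
    rcases r with _ | r <;> simp [genCoeff]
  | succ M ih =>
    rw [genCoeff, genCoeff, ih, mul_add, Finset.mul_sum, Finset.mul_sum, Finset.mul_sum]
    congr 1
    refine Finset.sum_congr rfl fun p hp => ?_
    rw [Finset.HasAntidiagonal.mem_antidiagonal] at hp
    rw [ih, ← hp, pow_add]
    linear_combination w * (((M : ℂ) + 1) ^ p.1)⁻¹ * (t ^ p.2 * genCoeff w y M p.2) *
      mul_tailWeight_mul t y p.1

lemma mul_depthSum_mul (l : ℕ) (t w x y : ℂ) :
    t * depthSum l (t * w) (t * x) (t * y) = t ^ l * depthSum l w x y := by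
  refine ((hasSum_depthSum l (t * w) (t * x) (t * y)).mul_left t).unique
    (((hasSum_depthSum l w x y).mul_left (t ^ l)).congr_fun fun m => ?_)
  rw [Finset.mul_sum, Finset.mul_sum]
  refine Finset.sum_congr rfl fun p hp => ?_
  rw [Finset.HasAntidiagonal.mem_antidiagonal] at hp
  rw [genCoeff_mul, ← hp, pow_add]
  linear_combination (((m : ℂ) + 1) ^ p.1)⁻¹ * (t ^ p.2 * genCoeff w y m p.2) *
    mul_headWeight_mul t x p.1

/-- The coefficient of `ζ(l)` in the expansion of `headSum x y - headSum y x`. -/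
noncomputable def zetaCoeff (l : ℕ) (x y : ℂ) : ℂ :=
  y / x * (headWeight y l - headWeight (y - x) l) -
    x / y * (headWeight x l - headWeight (x - y) l) +
    (headWeight ((y - x) / 2) l - headWeight (y - x) l -
      (headWeight ((x - y) / 2) l - headWeight (x - y) l))

lemma mul_zetaCoeff_mul (l : ℕ) {t : ℂ} (ht : t ≠ 0) (x y : ℂ) :
    t * zetaCoeff l (t * x) (t * y) = t ^ l * zetaCoeff l x y := by
  unfold zetaCoeff
  rw [mul_div_mul_left _ _ ht, mul_div_mul_left _ _ ht, ← mul_sub, ← mul_sub, mul_div_assoc,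
    mul_div_assoc]
  linear_combination y / x * (mul_headWeight_mul t y l - mul_headWeight_mul t (y - x) l) -
    x / y * (mul_headWeight_mul t x l - mul_headWeight_mul t (x - y) l) +
    (mul_headWeight_mul t ((y - x) / 2) l - mul_headWeight_mul t (y - x) l -
      (mul_headWeight_mul t ((x - y) / 2) l - mul_headWeight_mul t (x - y) l))

lemma hasSum_zetaCoeff {x y : ℂ} (hx : ‖x‖ ≤ 1 / 8) (hy : ‖y‖ ≤ 1 / 8) (hx0 : x ≠ 0)
    (hy0 : y ≠ 0) :
    HasSum (fun l => zetaCoeff l x y * (rz l : ℂ)) (headSum x y - headSum y x) := by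
  rw [headSum_sub_headSum hx hy hx0 hy0]
  have hyx : ‖y - x‖ ≤ 1 / 4 := (norm_sub_le _ _).trans (by linarith)
  have hxy : ‖x - y‖ ≤ 1 / 4 := (norm_sub_le _ _).trans (by linarith)
  have half : ∀ z : ℂ, ‖z‖ ≤ 1 / 4 → ‖z / 2‖ ≤ 1 / 4 := fun z hz => by
    rw [norm_div, RCLike.norm_ofNat]
    linarith [norm_nonneg z]
  have h1 := hasSum_headWeight_mul_rz (z := y) (by linarith)
  have h2 := hasSum_headWeight_mul_rz (z := x) (by linarith)
  have h3 := hasSum_headWeight_mul_rz hyx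
  have h4 := hasSum_headWeight_mul_rz hxy
  have h5 := hasSum_headWeight_mul_rz (half _ hyx)
  have h6 := hasSum_headWeight_mul_rz (half _ hxy)
  refine ((((h1.sub h3).mul_left (y / x)).sub ((h2.sub h4).mul_left (x / y))).add
    ((h5.sub h3).sub (h6.sub h4))).congr_fun fun l => ?_
  rw [zetaCoeff]
  ring

/-- A power series vanishing near the origin has vanishing coefficients. -/
lemma eq_zero_of_hasSum_pow {e : ℕ → ℂ} (h : ∀ᶠ t : ℂ in 𝓝 0, HasSum (fun l => t ^ l * e l) 0)
    (l : ℕ) : e l = 0 := by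
  have hp : HasFPowerSeriesAt (fun _ : ℂ => (0 : ℂ)) (FormalMultilinearSeries.ofScalars ℂ e) 0 := by
    rw [hasFPowerSeriesAt_iff]
    filter_upwards [h] with t ht
    simpa [FormalMultilinearSeries.coeff_ofScalars] using ht
  rw [← FormalMultilinearSeries.coeff_ofScalars (𝕜 := ℂ) (p := e) (n := l), hp.eq_zero]
  rfl

lemma depthSum_sub_depthSum (l : ℕ) {x y : ℂ} (hx0 : x ≠ 0) (hy0 : y ≠ 0) :
    depthSum l (y - x) (x + y) y - depthSum l (x - y) (y + x) x =
      zetaCoeff l x y * (rz l : ℂ) := by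
  rw [← sub_eq_zero]
  refine eq_zero_of_hasSum_pow (e := fun l => depthSum l (y - x) (x + y) y -
    depthSum l (x - y) (y + x) x - zetaCoeff l x y * (rz l : ℂ)) ?_ l
  have hsmall : ∀ z : ℂ, ∀ᶠ t : ℂ in 𝓝 0, ‖t * z‖ ≤ 1 / 8 := fun z => by
    have : Tendsto (fun t : ℂ => ‖t * z‖) (𝓝 0) (𝓝 0) := by
      have hc : Continuous fun t : ℂ => ‖t * z‖ := by fun_prop
      simpa using hc.tendsto 0
    exact this.eventually (eventually_le_nhds (by norm_num))
  filter_upwards [hsmall x, hsmall y] with t htx hty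
  rcases eq_or_ne t 0 with rfl | ht
  · convert hasSum_zero using 2 with l
    rcases l with _ | l <;> simp [depthSum, zetaCoeff, headWeight]
  · have h := (((hasSum_depthSum_eq_headSum htx hty).sub (hasSum_depthSum_eq_headSum hty htx)).sub
      (hasSum_zetaCoeff htx hty (mul_ne_zero ht hx0) (mul_ne_zero ht hy0))).mul_left t
    rw [sub_self, mul_zero] at h
    refine h.congr_fun fun l => ?_
    simp only [← mul_sub, ← mul_add]
    linear_combination -mul_depthSum_mul l t (y - x) (x + y) y +
      mul_depthSum_mul l t (x - y) (y + x) x + (rz l : ℂ) * mul_zetaCoeff_mul l ht x y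

lemma G_self {l : ℕ} (hl : l ≠ 0) (x y : ℂ) : G l l x y = 0 := by
  obtain ⟨k, rfl⟩ := Nat.exists_eq_add_one_of_ne_zero hl
  rw [G, Finset.filter_eq_empty_iff.2, Finset.sum_empty]
  intro c hc h
  rw [Finset.Nat.mem_antidiagonalTuple, Fin.sum_univ_succ] at hc
  have : ∑ _i : Fin k, 1 ≤ ∑ i : Fin k, c i.succ := Finset.sum_le_sum fun i _ => h.2 _
  simp only [Finset.sum_const, Finset.card_univ, Fintype.card_fin, smul_eq_mul, mul_one] at this
  omega

lemma mul_sum_Icc_G (N : ℕ) (x y : ℂ) :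
    (y - x) * ∑ n ∈ Finset.Icc 2 (N + 1),
        (y - x) ^ (n - 2) * (G (N + 2) n (x + y) y + (-1 : ℂ) ^ n * G (N + 2) n (y + x) x) =
      depthSum (N + 2) (y - x) (x + y) y - depthSum (N + 2) (x - y) (y + x) x := by
  have key : ∀ w X Y : ℂ, depthSum (N + 2) w X Y =
      headWeight X (N + 2) * (rz (N + 2) : ℂ) +
        ∑ k ∈ Finset.range N, w ^ (k + 1) * G (N + 2) (k + 2) X Y := fun w X Y => by
    rw [depthSum, Finset.sum_range_succ', Finset.sum_range_succ, G_self (by omega), G_one]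
    ring
  rw [key, key, Finset.mul_sum, add_comm y x, add_sub_add_left_eq_sub,
    ← Finset.sum_sub_distrib, ← Finset.Ico_succ_right_eq_Icc, Finset.sum_Ico_eq_sum_range]
  refine Finset.sum_congr (by simp) fun k _ => ?_
  rw [Nat.add_sub_cancel_left, add_comm 2 k, ← neg_sub y x, neg_pow (y - x)]
  ring

lemma mul_coeff_eq_zetaCoeff (N : ℕ) {x y : ℂ} (hx0 : x ≠ 0) (hy0 : y ≠ 0) :
    (y - x) * ((∑ j ∈ Finset.Icc 1 (N + 1), x ^ (N + 1 - j) * y ^ (j - 1))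
        - (1 + (-1 : ℂ) ^ (N + 2)) * (((2 : ℂ) ^ (N + 1) - 1) / (2 : ℂ) ^ (N + 1)) * (y - x) ^ N
        - (∑ k ∈ Finset.Icc 1 N,
            (N.choose k : ℂ) * (-1 : ℂ) ^ k * x ^ (N + 1 - k) * y ^ (k - 1))
        - (∑ k ∈ Finset.range N,
            (N.choose k : ℂ) * (-1 : ℂ) ^ (N + 2 - k) * x ^ (N - 1 - k) * y ^ (k + 1))) =
      zetaCoeff (N + 2) x y := by
  have s1 : (∑ j ∈ Finset.Icc 1 (N + 1), x ^ (N + 1 - j) * y ^ (j - 1)) * (y - x) =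
      y ^ (N + 1) - x ^ (N + 1) := by
    rw [← geom_sum₂_mul, ← Finset.Ico_succ_right_eq_Icc, Finset.sum_Ico_eq_sum_range]
    congr 1
    refine Finset.sum_congr (by simp) fun k _ => ?_
    rw [Nat.add_sub_cancel_left, mul_comm]
    congr 2
    omega
  have s2 : y * ∑ k ∈ Finset.Icc 1 N,
      (N.choose k : ℂ) * (-1 : ℂ) ^ k * x ^ (N + 1 - k) * y ^ (k - 1) =
      x * ((x - y) ^ N - x ^ N) := by
    rw [sub_eq_neg_add x y, add_pow, Finset.sum_range_succ', ← Finset.Ico_succ_right_eq_Icc,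
      Finset.sum_Ico_eq_sum_range]
    simp only [pow_zero, one_mul, Nat.choose_zero_right, Nat.cast_one, mul_one, Nat.sub_zero,
      add_sub_cancel_right, Finset.mul_sum]
    refine Finset.sum_congr (by simp) fun k hk => ?_
    have hk : k < N := by simpa using hk
    rw [add_comm 1 k, Nat.add_sub_cancel, neg_pow y, pow_succ y,
      show N + 1 - (k + 1) = N - (k + 1) + 1 by omega]
    ring
  have s3 : x * ∑ k ∈ Finset.range N,
      (N.choose k : ℂ) * (-1 : ℂ) ^ (N + 2 - k) * x ^ (N - 1 - k) * y ^ (k + 1) =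
      y * ((y - x) ^ N - y ^ N) := by
    rw [sub_eq_add_neg y x, add_pow, Finset.sum_range_succ]
    simp only [Nat.sub_self, pow_zero, mul_one, Nat.choose_self, Nat.cast_one,
      add_sub_cancel_right, Finset.mul_sum]
    refine Finset.sum_congr rfl fun k hk => ?_
    have hk : k < N := by simpa using hk
    rw [neg_pow x, show N + 2 - k = N - k + 2 by omega, show N - k = N - 1 - k + 1 by omega]
    ring
  have s2' := eq_div_of_mul_eq hy0 ((mul_comm _ _).trans s2)
  have s3' := eq_div_of_mul_eq hx0 ((mul_comm _ _).trans s3)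
  rw [zetaCoeff, s2', s3']
  simp only [headWeight, if_pos (show 2 ≤ N + 2 by omega), show N + 2 - 1 = N + 1 by omega]
  rw [← neg_sub y x, neg_div, neg_pow (y - x), neg_pow (y - x), neg_pow ((y - x) / 2), div_pow]
  rw [mul_sub, mul_sub, mul_sub, mul_comm (y - x), s1]
  have h2 : (2 : ℂ) ^ (N + 1) ≠ 0 := pow_ne_zero _ two_ne_zero
  field_simp
  ring

lemma continuous_G {X : Type*} [TopologicalSpace X] (l n : ℕ) {f g : X → ℂ} (hf : Continuous f)
    (hg : Continuous g) : Continuous fun z => G l n (f z) (g z) := by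
  rcases n with _ | k
  · exact continuous_const
  · unfold G
    fun_prop

/-- Two continuous functions agreeing off the lines `x = 0`, `y = 0`, `x = y` are equal. -/
lemma eq_of_eq_off_lines {f g : ℂ → ℂ → ℂ} (hf : Continuous fun p : ℂ × ℂ => f p.1 p.2)
    (hg : Continuous fun p : ℂ × ℂ => g p.1 p.2)
    (h : ∀ x y, x ≠ 0 → y ≠ 0 → x ≠ y → f x y = g x y) (x y : ℂ) : f x y = g x y := by
  have hx : ∀ y, y ≠ 0 → ∀ x, f x y = g x y := fun y hy x => by
    have hd : Dense (({0, y} : Set ℂ)ᶜ) := (Set.toFinite _).countable.dense_compl ℂ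
    refine congrFun (Continuous.ext_on hd (f := fun x => f x y) (g := fun x => g x y)
      (hf.comp (Continuous.prodMk_left y)) (hg.comp (Continuous.prodMk_left y))
      fun z hz => ?_) x
    rw [Set.mem_compl_iff, Set.mem_insert_iff, Set.mem_singleton_iff, not_or] at hz
    exact h z y hz.1 hy hz.2
  exact congrFun (Continuous.ext_on (dense_compl_singleton (0 : ℂ)) (f := f x) (g := g x)
    (hf.comp (Continuous.prodMk_right x)) (hg.comp (Continuous.prodMk_right x))
    fun z hz => hx z hz x) y

end

/-- Theorem 2 of Machide: for `l ≥ 3` and complex `x, y`,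
`Σ_{n=2}^{l-1} (y-x)^(n-2) (G_l^n(x+y,y) + (-1)^n G_l^n(y+x,x))` equals a certain
explicit multiple of `ζ(l)`.  The coefficient
`(y^(l+1)-x^(l+1))/(yx(y-x)) - (y-x)^(l-2)((1+(-1)^l)(2^(l-1)-1)/2^(l-1) + (-1)^l x/y + y/x)`
is interpreted for all `x, y` (including `x = y` and `xy = 0`) by its polynomial limit,
which is written out explicitly below (the polynomial agrees with the displayed rational
expression whenever `x ≠ y` and `xy ≠ 0`). -/
theorem weighted_sum_depth_relation (l : ℕ) (hl : 3 ≤ l) (x y : ℂ) :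
    ∑ n ∈ Finset.Icc 2 (l - 1),
      (y - x) ^ (n - 2) * (G l n (x + y) y + (-1 : ℂ) ^ n * G l n (y + x) x)
    = ((∑ j ∈ Finset.Icc 1 (l - 1), x ^ (l - 1 - j) * y ^ (j - 1))
        - (1 + (-1 : ℂ) ^ l) * (((2 : ℂ) ^ (l - 1) - 1) / (2 : ℂ) ^ (l - 1))
            * (y - x) ^ (l - 2)
        - (∑ k ∈ Finset.Icc 1 (l - 2),
            ((l - 2).choose k : ℂ) * (-1 : ℂ) ^ k * x ^ (l - 1 - k) * y ^ (k - 1))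
        - (∑ k ∈ Finset.range (l - 2),
            ((l - 2).choose k : ℂ) * (-1 : ℂ) ^ (l - k) * x ^ (l - 3 - k) * y ^ (k + 1)))
      * (rz l : ℂ) := by
  obtain ⟨N, rfl⟩ : ∃ N, l = N + 2 := ⟨l - 2, by omega⟩
  revert x y
  apply eq_of_eq_off_lines
  · refine continuous_finsetSum _ fun n _ => ?_
    have h1 := continuous_G (N + 2) n (continuous_fst.add continuous_snd) (continuous_snd (X := ℂ))
    have h2 := continuous_G (N + 2) n (continuous_snd.add continuous_fst)
      (continuous_fst (X := ℂ) (Y := ℂ))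
    fun_prop
  · fun_prop
  · intro x y hx0 hy0 hxy
    refine mul_left_cancel₀ (sub_ne_zero.2 hxy.symm) ?_
    rw [← mul_assoc]
    exact (mul_sum_Icc_G N x y).trans ((depthSum_sub_depthSum (N + 2) hx0 hy0).trans
      (congrArg (· * (rz (N + 2) : ℂ)) (mul_coeff_eq_zetaCoeff N hx0 hy0).symm))
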